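/- arXiv:1305.4743 — 5 statements merged into one kernel-verified Lean document; each statement's English description precedes it below -/
import Mathlib

section
/- For any positive integer k, the improper integral over the real line of (sin(u)/u)^{2k} du equals (π/(2k-1)!) · Σ_{i=0}^{k-1} (-1)^i · C(2k, i) · (k-i)^{2k-1}. -/
open Real MeasureTheory Finset

theorem integral_pow_mul_exp_neg_mul_Ioi (n : ℕ) {u : ℝ} (hu : 0 < u) :
    ∫ t in Set.Ioi (0 : ℝ), t ^ n * exp (-(u * t)) = n.factorial / u ^ (n + 1) := by
  have h := integral_rpow_mul_exp_neg_mul_Ioi (a := n + 1) (by positivity) hu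
  rw [Gamma_nat_eq_factorial] at h
  simp only [add_sub_cancel_right, rpow_natCast] at h
  rw [h, ← Nat.cast_succ, rpow_natCast, one_div, inv_pow, div_eq_inv_mul]

theorem integrableOn_sin_pow_mul_exp_neg_mul_Ioi (n : ℕ) {t : ℝ} (ht : 0 < t) :
    IntegrableOn (fun u ↦ sin u ^ n * exp (-(t * u))) (Set.Ioi 0) := by
  have h : IntegrableOn (fun u ↦ exp (-(t * u))) (Set.Ioi 0) := by
    simpa using exp_neg_integrableOn_Ioi 0 ht
  refine h.mono' (by fun_prop) (.of_forall fun u ↦ ?_)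
  rw [norm_mul, norm_pow, norm_of_nonneg (exp_pos _).le]
  exact mul_le_of_le_one_left (exp_pos _).le (pow_le_one₀ (norm_nonneg _) (abs_sin_le_one u))

theorem integral_sin_pow_add_two_mul_exp_neg_mul_Ioi (n : ℕ) {t : ℝ} (ht : 0 < t) :
    (t ^ 2 + (n + 2) ^ 2) * ∫ u in Set.Ioi (0 : ℝ), sin u ^ (n + 2) * exp (-(t * u)) =
      (n + 2) * (n + 1) * ∫ u in Set.Ioi (0 : ℝ), sin u ^ n * exp (-(t * u)) := by
  have hderiv (u : ℝ) : HasDerivAt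
      (fun u ↦ -(t * sin u ^ (n + 2) + (n + 2) * (sin u ^ (n + 1) * cos u)) * exp (-(t * u)))
      ((t ^ 2 + (n + 2) ^ 2) * (sin u ^ (n + 2) * exp (-(t * u))) -
        (n + 2) * (n + 1) * (sin u ^ n * exp (-(t * u)))) u := by
    have hs := hasDerivAt_sin u
    have he : HasDerivAt (fun u ↦ exp (-(t * u))) (exp (-(t * u)) * -(t * 1)) u :=
      (((hasDerivAt_id u).const_mul t).neg).exp
    convert! (((hs.pow (n + 2)).const_mul t).add
      (((hs.pow (n + 1)).mul (hasDerivAt_cos u)).const_mul ((n : ℝ) + 2))).neg.mul he using 1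
    have hc : cos u ^ 2 = 1 - sin u ^ 2 := cos_sq' u
    simp only [Pi.neg_apply, Pi.add_apply, Pi.mul_apply, Pi.pow_apply, Nat.add_one_sub_one,
      Nat.cast_add, Nat.cast_one, Nat.cast_ofNat]
    linear_combination (((n : ℝ) + 2) * (n + 1) * sin u ^ n * exp (-(t * u))) * hc
  have hint (m : ℕ) (c : ℝ) := (integrableOn_sin_pow_mul_exp_neg_mul_Ioi m ht).const_mul c
  have hlim : Filter.Tendsto
      (fun u ↦ -(t * sin u ^ (n + 2) + (n + 2) * (sin u ^ (n + 1) * cos u)) * exp (-(t * u)))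
      Filter.atTop (nhds 0) := by
    have he : Filter.Tendsto (fun u ↦ exp (-(t * u))) Filter.atTop (nhds 0) :=
      tendsto_exp_neg_atTop_nhds_zero.comp (Filter.tendsto_id.const_mul_atTop ht)
    refine Filter.isBoundedUnder_le_mul_tendsto_zero ?_ he
    refine Filter.isBoundedUnder_of ⟨t + (n + 2), fun u ↦ ?_⟩
    have hp (m : ℕ) : |sin u| ^ m ≤ 1 := pow_le_one₀ (abs_nonneg _) (abs_sin_le_one u)
    simp only [Function.comp_apply, norm_neg, norm_eq_abs]
    refine (abs_add_le _ _).trans ?_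
    rw [abs_mul, abs_mul, abs_mul, abs_pow, abs_pow, abs_of_pos ht,
      abs_of_pos (by positivity : (0 : ℝ) < n + 2)]
    gcongr
    · exact mul_le_of_le_one_right ht.le (hp _)
    · exact mul_le_of_le_one_right (by positivity)
        (mul_le_one₀ (hp _) (abs_nonneg _) (abs_cos_le_one u))
  have h := integral_Ioi_of_hasDerivAt_of_tendsto' (fun u _ ↦ hderiv u)
    ((hint (n + 2) _).sub (hint n _)) hlim
  rw [integral_sub (hint (n + 2) _) (hint n _), integral_const_mul, integral_const_mul] at h
  simpa [sub_eq_zero] using h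

theorem integral_sin_pow_two_mul_mul_exp_neg_mul_Ioi (k : ℕ) {t : ℝ} (ht : 0 < t) :
    ∫ u in Set.Ioi (0 : ℝ), sin u ^ (2 * k) * exp (-(t * u)) =
      (2 * k).factorial / (t * ∏ j ∈ range k, (t ^ 2 + (2 * (j + 1)) ^ 2)) := by
  induction k with
  | zero => simpa using integral_pow_mul_exp_neg_mul_Ioi 0 ht
  | succ k ih =>
    have h := integral_sin_pow_add_two_mul_exp_neg_mul_Ioi (2 * k) ht
    have hP : 0 < ∏ j ∈ range k, (t ^ 2 + (2 * ((j : ℝ) + 1)) ^ 2) :=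
      prod_pos fun j _ ↦ by positivity
    rw [ih] at h
    rw [prod_range_succ, show 2 * (k + 1) = 2 * k + 2 by ring, Nat.factorial_succ,
      Nat.factorial_succ]
    push_cast at h ⊢
    rw [eq_div_iff (by positivity)]
    rw [mul_div_assoc', eq_div_iff (by positivity)] at h
    linear_combination h

theorem prod_range_erase_sub (j m : ℕ) :
    ∏ l ∈ (range (j + m + 1)).erase j, ((l : ℝ) - j) =
      (-1) ^ j * j.factorial * m.factorial := by
  induction m with
  | zero =>
    rw [add_zero, range_add_one, erase_insert notMem_range_self]
    induction j with
    | zero => simp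
    | succ j ih =>
      rw [prod_range_succ', Nat.factorial_succ]
      simp only [Nat.cast_add, Nat.cast_one, add_sub_add_right_eq_sub, ih]
      push_cast
      ring
  | succ m ih =>
    rw [← add_assoc, range_add_one, erase_insert_of_ne (by omega), prod_insert (by simp), ih,
      Nat.factorial_succ]
    push_cast
    ring

theorem prod_range_natCast_add_two (n j : ℕ) :
    ∏ l ∈ range n, ((l : ℝ) + j + 2) = (n + j + 1).factorial / (j + 1).factorial := by
  have h := Nat.factorial_mul_ascFactorial (j + 1) n
  rw [Nat.ascFactorial_eq_prod_range] at h
  rw [eq_div_iff (by positivity), show n + j + 1 = j + 1 + n by ring, ← h]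
  push_cast
  rw [mul_comm]
  congr 1
  exact prod_congr rfl fun l _ ↦ by ring

theorem nodalWeight_neg_sq_even (j m : ℕ) :
    Lagrange.nodalWeight (range (j + m + 1)) (fun l : ℕ ↦ -(2 * ((l : ℝ) + 1)) ^ 2 : ℕ → ℝ) j =
      (-1 : ℝ) ^ j * (2 * ((j : ℝ) + 1) ^ 2) /
        (4 ^ (j + m) * m.factorial * (2 * j + m + 2).factorial) := by
  have hj : j ∈ range (j + m + 1) := by simp
  have h := mul_prod_erase (range (j + m + 1)) (fun l : ℕ ↦ (l : ℝ) + (j : ℝ) + 2) hj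
  rw [prod_range_natCast_add_two, show j + m + 1 + j + 1 = 2 * j + m + 2 by ring] at h
  have h' : ∏ l ∈ (range (j + m + 1)).erase j, ((l : ℝ) + j + 2) =
      (2 * j + m + 2).factorial / (j + 1).factorial / (2 * (j + 1)) := by
    rw [← h]; field_simp; ring
  rw [Lagrange.nodalWeight, prod_inv_distrib]
  have hfac (l : ℕ) : -(2 * ((j : ℝ) + 1)) ^ 2 - -(2 * ((l : ℝ) + 1)) ^ 2 =
      4 * (((l : ℝ) - j) * (l + j + 2)) := by ring
  simp only [hfac]
  rw [prod_mul_distrib, prod_mul_distrib, prod_const, card_erase_of_mem hj, card_range,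
    prod_range_erase_sub, h', Nat.factorial_succ j]
  push_cast
  rw [inv_eq_iff_eq_inv, inv_div]
  have : ((-1 : ℝ) ^ j) ^ 2 = 1 := by rw [← pow_mul, mul_comm, pow_mul]; simp
  field_simp
  rw [this]

theorem partialFraction_pow_div_prod_sq_add_sq (n : ℕ) (t : ℝ) :
    (2 * (n + 1)).factorial * t ^ (2 * n) /
        ∏ j ∈ range (n + 1), (t ^ 2 + (2 * ((j : ℝ) + 1)) ^ 2) =
      ∑ j ∈ range (n + 1), (-1) ^ (n - j) * (2 * (n + 1)).choose (n - j) *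
        (2 * ((j : ℝ) + 1) ^ (2 * n + 2)) * (t ^ 2 + (2 * ((j : ℝ) + 1)) ^ 2)⁻¹ := by
  set v : ℕ → ℝ := fun l ↦ -(2 * ((l : ℝ) + 1)) ^ 2 with hv
  have hinj : Set.InjOn v (range (n + 1)) := by
    intro a _ b _ hab
    have := (sq_eq_sq₀ (by positivity) (by positivity)).1 (neg_injective hab)
    exact_mod_cast (by linarith : (a : ℝ) = b)
  have hP : 0 < ∏ j ∈ range (n + 1), (t ^ 2 + (2 * ((j : ℝ) + 1)) ^ 2) :=
    prod_pos fun j _ ↦ by positivity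
  have hX := congrArg (Polynomial.eval (t ^ 2)) (Lagrange.eq_interpolate
    (f := (Polynomial.X : Polynomial ℝ) ^ n) hinj
    (by rw [Polynomial.degree_X_pow, card_range]; exact_mod_cast n.lt_succ_self))
  rw [Lagrange.eval_interpolate_not_at_node _ (fun i _ ↦ by
    have : 0 < t ^ 2 + (2 * ((i : ℝ) + 1)) ^ 2 := by positivity
    simp only [hv]; linarith), Lagrange.eval_nodal] at hX
  simp only [hv, sub_neg_eq_add, Polynomial.eval_pow, Polynomial.eval_X] at hX
  rw [pow_mul, hX, mul_left_comm, mul_div_cancel_left₀ _ hP.ne', mul_sum]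
  refine sum_congr rfl fun j hj ↦ ?_
  obtain ⟨m, rfl⟩ := Nat.exists_eq_add_of_le (Nat.lt_succ_iff.1 (mem_range.1 hj))
  rw [nodalWeight_neg_sq_even, Nat.add_sub_cancel_left, Nat.cast_choose ℝ (by omega),
    show 2 * (j + m + 1) - m = 2 * j + m + 2 by omega,
    show -(2 * ((j : ℝ) + 1)) ^ 2 = (-1) * (4 * (j + 1) ^ 2) by ring,
    mul_pow (-1), mul_pow 4, ← pow_mul, pow_add (-1 : ℝ)]
  have : ((-1 : ℝ) ^ j) ^ 2 = 1 := by rw [← pow_mul, mul_comm, pow_mul]; simp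
  have hD : t ^ 2 + (2 * ((j : ℝ) + 1)) ^ 2 ≠ 0 := by positivity
  field_simp
  rw [this]
  ring

theorem integrable_inv_sq_add_sq {a : ℝ} (ha : 0 < a) :
    Integrable fun t : ℝ ↦ (t ^ 2 + a ^ 2)⁻¹ := by
  convert! (integrable_inv_one_add_sq.comp_mul_left' (inv_pos.2 ha).ne').const_mul (a ^ 2)⁻¹
    using 2 with t
  field_simp
  ring

theorem integral_Ioi_inv_sq_add_sq {a : ℝ} (ha : 0 < a) :
    ∫ t in Set.Ioi (0 : ℝ), (t ^ 2 + a ^ 2)⁻¹ = π / (2 * a) := by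
  have h := integral_comp_mul_left_Ioi (fun x : ℝ ↦ (1 + x ^ 2)⁻¹) 0 (inv_pos.2 ha)
  rw [mul_zero, integral_Ioi_inv_one_add_sq, arctan_zero, sub_zero, smul_eq_mul, inv_inv] at h
  calc ∫ t in Set.Ioi (0 : ℝ), (t ^ 2 + a ^ 2)⁻¹
      = ∫ t in Set.Ioi (0 : ℝ), (a ^ 2)⁻¹ * (1 + (a⁻¹ * t) ^ 2)⁻¹ := by
        congr 1 with t
        field_simp
        ring
    _ = π / (2 * a) := by
        rw [integral_const_mul, h]
        field_simp

theorem integral_Ioi_sin_div_pow (n : ℕ) :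
    (2 * n + 1).factorial * ∫ u in Set.Ioi (0 : ℝ), (sin u / u) ^ (2 * (n + 1)) =
      ∑ j ∈ range (n + 1), (-1) ^ (n - j) * (2 * (n + 1)).choose (n - j) *
        (2 * ((j : ℝ) + 1) ^ (2 * n + 2)) * (π / (2 * (2 * ((j : ℝ) + 1)))) := by
  set c : ℕ → ℝ := fun j ↦ (-1) ^ (n - j) * (2 * (n + 1)).choose (n - j) *
        (2 * ((j : ℝ) + 1) ^ (2 * n + 2))
  let F : ℝ → ℝ → ℝ := fun u t ↦ sin u ^ (2 * (n + 1)) * (t ^ (2 * n + 1) * exp (-(t * u)))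
  have hF0 {u t : ℝ} (ht : 0 < t) : 0 ≤ F u t :=
    mul_nonneg ((even_two_mul _).pow_nonneg _) (by positivity)
  have hF (t : ℝ) : (fun u ↦ F u t) =
      fun u ↦ t ^ (2 * n + 1) * (sin u ^ (2 * (n + 1)) * exp (-(t * u))) := by
    ext u; simp only [F]; ring
  have hinner {t : ℝ} (ht : 0 < t) : ∫ u in Set.Ioi 0, F u t =
      ∑ j ∈ range (n + 1), c j * (t ^ 2 + (2 * ((j : ℝ) + 1)) ^ 2)⁻¹ := by
    rw [hF, integral_const_mul, integral_sin_pow_two_mul_mul_exp_neg_mul_Ioi _ ht,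
      ← partialFraction_pow_div_prod_sq_add_sq n t, pow_succ t (2 * n)]
    field_simp
  have hcint (j : ℕ) : Integrable (fun t : ℝ ↦ c j * (t ^ 2 + (2 * ((j : ℝ) + 1)) ^ 2)⁻¹)
      (volume.restrict (Set.Ioi 0)) :=
    ((integrable_inv_sq_add_sq (by positivity)).const_mul _).integrableOn
  have hFint : Integrable (Function.uncurry F)
      ((volume.restrict (Set.Ioi 0)).prod (volume.restrict (Set.Ioi 0))) := by
    have hcont : Continuous (Function.uncurry F) := by
      simp only [F, Function.uncurry_def]
      fun_prop
    refine (integrable_prod_iff' hcont.aestronglyMeasurable).2 ⟨?_, ?_⟩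
    · filter_upwards [ae_restrict_mem measurableSet_Ioi] with t ht
      simp only [Function.uncurry_apply_pair, hF]
      exact (integrableOn_sin_pow_mul_exp_neg_mul_Ioi _ ht).const_mul _
    · refine (integrable_finsetSum (range (n + 1)) fun j _ ↦ hcint j).congr ?_
      filter_upwards [ae_restrict_mem measurableSet_Ioi] with t ht
      rw [← hinner ht]
      exact integral_congr_ae (.of_forall fun u ↦ (norm_of_nonneg (hF0 ht)).symm)
  calc (2 * n + 1).factorial * ∫ u in Set.Ioi (0 : ℝ), (sin u / u) ^ (2 * (n + 1))
      = ∫ u in Set.Ioi (0 : ℝ), ∫ t in Set.Ioi (0 : ℝ), F u t := by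
        rw [← integral_const_mul]
        refine setIntegral_congr_fun measurableSet_Ioi fun u hu ↦ ?_
        simp only [F, integral_const_mul, mul_comm _ u]
        rw [integral_pow_mul_exp_neg_mul_Ioi _ hu, div_pow]
        ring
    _ = ∫ t in Set.Ioi (0 : ℝ), ∫ u in Set.Ioi (0 : ℝ), F u t := integral_integral_swap hFint
    _ = ∫ t in Set.Ioi (0 : ℝ),
          ∑ j ∈ range (n + 1), c j * (t ^ 2 + (2 * ((j : ℝ) + 1)) ^ 2)⁻¹ :=
        setIntegral_congr_fun measurableSet_Ioi fun t ht ↦ hinner ht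
    _ = ∑ j ∈ range (n + 1), c j * (π / (2 * (2 * ((j : ℝ) + 1)))) := by
        rw [integral_finsetSum _ fun j _ ↦ hcint j]
        refine sum_congr rfl fun j _ ↦ ?_
        rw [integral_const_mul, integral_Ioi_inv_sq_add_sq (by positivity)]

theorem dirichlet_integral (k : ℕ) (hk : 1 ≤ k) :
    ∫ u : ℝ, (Real.sin u / u) ^ (2 * k) =
      π / (Nat.factorial (2 * k - 1)) *
        ∑ i ∈ Finset.range k,
          (-1 : ℝ) ^ i * (Nat.choose (2 * k) i) * ((k : ℝ) - i) ^ (2 * k - 1) := by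
  obtain ⟨n, rfl⟩ := Nat.exists_eq_add_of_le' hk
  have heven : ∫ u : ℝ, (sin u / u) ^ (2 * (n + 1)) =
      2 * ∫ u in Set.Ioi (0 : ℝ), (sin u / u) ^ (2 * (n + 1)) := by
    rw [← integral_comp_abs (f := fun u ↦ (sin u / u) ^ (2 * (n + 1)))]
    congr 1 with u
    rcases abs_choice u with h | h <;> simp [h]
  have h := integral_Ioi_sin_div_pow n
  rw [heven, show 2 * (n + 1) - 1 = 2 * n + 1 by omega, div_mul_eq_mul_div,
    eq_div_iff (by positivity), mul_comm, mul_left_comm, h, ← sum_range_reflect, mul_sum, mul_sum]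
  refine sum_congr rfl fun i hi ↦ ?_
  have hi' : i ≤ n := Nat.lt_succ_iff.1 (mem_range.1 hi)
  rw [Nat.add_sub_cancel, Nat.sub_sub_self hi', Nat.cast_sub hi',
    show (n : ℝ) - i + 1 = ((n + 1 : ℕ) : ℝ) - i by push_cast; ring, pow_succ _ (2 * n + 1)]
  have hpos : ((n + 1 : ℕ) : ℝ) - i ≠ 0 := by
    have : (i : ℝ) ≤ n := by exact_mod_cast hi'
    push_cast
    linarith
  field_simp
end

section
/- For positive integers n and k, the integral I_{n,k} := ∫_{-∞}^{∞} [sin²(t - πn/2) / (t² - π²n²/4)²]^k dt equals (πn)^{-2k} · Σ_{j=0}^{k-1} C(2j+2k-1, 2k-1) · (2π (πn)^{-2j} (-1/4)^j / (2k-2j-1)!) · Σ_{i=0}^{k-1} (-1)^i C(2k, i) (k-i)^{2k-2j-1}. -/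
open Real MeasureTheory Finset

/-- `sin x ^ a / x ^ m` in terms of the entire function `sinc`. -/
theorem sin_pow_div_pow_eq_mul_sinc {a m : ℕ} (h : m < a) (x : ℝ) :
    Real.sin x ^ a / x ^ m = Real.sin x ^ (a - m) * Real.sinc x ^ m := by
  obtain ⟨d, rfl⟩ := Nat.exists_eq_add_of_lt h
  rcases eq_or_ne x 0 with rfl | hx
  · have : m + d + 1 - m ≠ 0 := by omega
    simp [this]
  · rw [Real.sinc_of_ne_zero hx, show m + d + 1 - m = d + 1 by omega, div_pow]
    field_simp
    ring

theorem abs_sin_pow_div_pow_le {a m : ℕ} (hm : 2 ≤ m) (h : m ≤ a) (x : ℝ) :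
    |Real.sin x ^ a / x ^ m| ≤ 2 * (1 + x ^ 2)⁻¹ := by
  obtain ⟨d, rfl⟩ := Nat.exists_eq_add_of_le h
  have h1 : |Real.sin x / x| ≤ 1 := by
    rw [abs_div]
    exact div_le_one_of_le₀ Real.abs_sin_le_abs (abs_nonneg x)
  have h2 : (Real.sin x / x) ^ 2 * x ^ 2 ≤ 1 := by
    rcases eq_or_ne x 0 with rfl | hx
    · simp
    · rw [div_pow, div_mul_cancel₀ _ (pow_ne_zero 2 hx)]
      exact Real.sin_sq_le_one x
  have h3 : |Real.sin x ^ (m + d) / x ^ m| ≤ (Real.sin x / x) ^ 2 := by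
    rw [pow_add, mul_div_right_comm, ← div_pow, abs_mul, abs_pow, abs_pow, ← sq_abs (_ / x)]
    calc |Real.sin x / x| ^ m * |Real.sin x| ^ d ≤ |Real.sin x / x| ^ 2 * 1 := by
          gcongr ?_ * ?_
          · exact pow_le_pow_of_le_one (abs_nonneg _) h1 hm
          · exact pow_le_one₀ (abs_nonneg _) (Real.abs_sin_le_one x)
      _ = _ := mul_one _
  have h4 : (Real.sin x / x) ^ 2 ≤ 1 := (sq_le_one_iff_abs_le_one _).2 h1
  rw [← div_eq_mul_inv, le_div_iff₀ (by positivity)]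
  nlinarith [sq_nonneg x]

theorem integrable_sin_pow_div_pow {a m : ℕ} (hm : 2 ≤ m) (h : m ≤ a) :
    Integrable fun x : ℝ ↦ Real.sin x ^ a / x ^ m :=
  (integrable_inv_one_add_sq.const_mul 2).mono'
    (Measurable.aestronglyMeasurable (by fun_prop))
    (Filter.Eventually.of_forall fun x ↦ abs_sin_pow_div_pow_le hm h x)

/-- The tent function, whose Fourier transform is `w ↦ (sin (π w) / (π w)) ^ 2`. -/
noncomputable def tent (x : ℝ) : ℂ := ((max 0 (1 - |x|) : ℝ) : ℂ)

theorem continuous_tent : Continuous tent := by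
  unfold tent; fun_prop

theorem tent_eq_zero {x : ℝ} (hx : x ∉ Set.Ioc (-1 : ℝ) 1) : tent x = 0 := by
  have : 1 - |x| ≤ 0 := by
    by_contra! h
    have := abs_lt.1 (show |x| < 1 by linarith)
    exact hx ⟨this.1, this.2.le⟩
  simp [tent, this]

theorem integrable_tent : Integrable tent := by
  refine continuous_tent.integrable_of_hasCompactSupport
    (HasCompactSupport.intro (isCompact_Icc (a := (-1 : ℝ)) (b := 1)) fun x hx ↦ tent_eq_zero ?_)
  exact fun h ↦ hx (Set.Ioc_subset_Icc_self h)

theorem integral_one_sub_mul_exp {c : ℂ} (hc : c ≠ 0) :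
    ∫ x in (0 : ℝ)..1, (1 - (x : ℂ)) * Complex.exp (c * x) =
      (Complex.exp c - 1 - c) / c ^ 2 := by
  have hd : ∀ x ∈ Set.uIcc (0 : ℝ) 1, HasDerivAt
      (fun x : ℝ ↦ Complex.exp (c * x) * ((1 - (x : ℂ)) / c + 1 / c ^ 2))
      ((1 - (x : ℂ)) * Complex.exp (c * x)) x := by
    intro x _
    have hx : HasDerivAt (fun x : ℝ ↦ (x : ℂ)) 1 x := Complex.ofRealCLM.hasDerivAt
    have h1 := (hx.const_mul c).cexp
    have h2 := ((hx.const_sub 1).div_const c).add_const (1 / c ^ 2)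
    convert! h1.mul h2 using 1
    field_simp
    ring
  rw [intervalIntegral.integral_eq_sub_of_hasDerivAt hd
    (Continuous.intervalIntegrable (by fun_prop) _ _)]
  simp
  field_simp
  ring

open FourierTransform in
theorem fourier_tent {w : ℝ} (hw : w ≠ 0) :
    𝓕 tent w = (((Real.sin (π * w)) ^ 2 / (π * w) ^ 2 : ℝ) : ℂ) := by
  set c : ℂ := -2 * π * w * Complex.I with hc
  have hc0 : c ≠ 0 := by simp [hc, hw, Real.pi_ne_zero]
  rw [Real.fourier_real_eq_integral_exp_smul]
  have h0 : ∀ v : ℝ, Complex.exp (↑(-2 * π * v * w) * Complex.I) • tent v =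
      tent v * Complex.exp (c * v) := by
    intro v
    rw [smul_eq_mul, mul_comm, hc]
    congr 2
    push_cast
    ring
  simp_rw [h0]
  have hcont : Continuous fun v : ℝ ↦ tent v * Complex.exp (c * v) :=
    continuous_tent.mul (by fun_prop)
  rw [← setIntegral_eq_integral_of_forall_compl_eq_zero (s := Set.Ioc (-1 : ℝ) 1)
      (fun x hx ↦ by rw [tent_eq_zero hx, zero_mul]),
    ← intervalIntegral.integral_of_le (by norm_num),
    ← intervalIntegral.integral_add_adjacent_intervals (b := 0)
      (hcont.intervalIntegrable _ _) (hcont.intervalIntegrable _ _)]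
  have h1 : ∀ d : ℂ, ∀ x ∈ Set.uIcc (0 : ℝ) 1,
      tent x * Complex.exp (d * x) = (1 - (x : ℂ)) * Complex.exp (d * x) := by
    intro d x hx
    rw [Set.uIcc_of_le zero_le_one] at hx
    rw [tent, abs_of_nonneg hx.1, max_eq_right (by linarith [hx.2])]
    push_cast
    rfl
  have h2 : ∫ x in (-1 : ℝ)..0, tent x * Complex.exp (c * x) =
      ∫ x in (0 : ℝ)..1, tent x * Complex.exp (-c * x) := by
    have := intervalIntegral.integral_comp_neg (a := 0) (b := 1)
      (fun x : ℝ ↦ tent x * Complex.exp (c * x))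
    simp only [neg_zero] at this
    rw [← this]
    congr 1
    ext x
    simp [tent]
  rw [h2, intervalIntegral.integral_congr (h1 _), intervalIntegral.integral_congr (h1 _),
    integral_one_sub_mul_exp hc0, integral_one_sub_mul_exp (neg_ne_zero.2 hc0)]
  have hw' : (w : ℂ) ≠ 0 := by exact_mod_cast hw
  have hp : (π : ℂ) ≠ 0 := by exact_mod_cast Real.pi_ne_zero
  push_cast
  rw [Complex.sin]
  have e1 : Complex.exp c = Complex.exp (-(π * w) * Complex.I) ^ 2 := by
    rw [← Complex.exp_nat_mul, hc]; congr 1; push_cast; ring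
  have e2 : Complex.exp (-c) = Complex.exp (π * w * Complex.I) ^ 2 := by
    rw [← Complex.exp_nat_mul, hc]; congr 1; push_cast; ring
  have e3 : Complex.exp (-(π * w) * Complex.I) * Complex.exp (π * w * Complex.I) = 1 := by
    rw [← Complex.exp_add]; simp
  have e4 : c ^ 2 = -4 * (π * w) ^ 2 := by
    rw [hc]; ring_nf; rw [Complex.I_sq]; ring
  rw [neg_sq, e1, e2, e4]
  generalize Complex.exp (-(π * w) * Complex.I) = A at *
  generalize Complex.exp (π * w * Complex.I) = B at *
  field_simp
  rw [Complex.I_sq]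
  linear_combination (-8) * e3

theorem integral_sin_sq_div_sq : ∫ x : ℝ, Real.sin x ^ 2 / x ^ 2 = π := by
  open FourierTransform in
  have hae : 𝓕 tent =ᵐ[volume] fun w : ℝ ↦ ((Real.sin (π * w) ^ 2 / (π * w) ^ 2 : ℝ) : ℂ) := by
    filter_upwards [compl_mem_ae_iff.2 (measure_singleton (0 : ℝ))] with w hw
    exact fourier_tent hw
  have hintg : Integrable fun w : ℝ ↦ Real.sin (π * w) ^ 2 / (π * w) ^ 2 :=
    (integrable_sin_pow_div_pow le_rfl le_rfl).comp_mul_left' Real.pi_ne_zero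
  have hinv := congr_fun (continuous_tent.fourierInv_fourier_eq integrable_tent
    (hintg.ofReal.congr hae.symm)) 0
  rw [Real.fourierInv_eq'] at hinv
  simp only [inner_zero_right, mul_zero, Complex.ofReal_zero, zero_mul, Complex.exp_zero,
    one_smul] at hinv
  rw [integral_congr_ae hae, integral_complex_ofReal,
    Measure.integral_comp_mul_left (fun x : ℝ ↦ Real.sin x ^ 2 / x ^ 2) π] at hinv
  simp only [tent, abs_zero, sub_zero, zero_le_one, sup_of_le_right, Complex.ofReal_one,
    Complex.ofReal_eq_one] at hinv
  rw [abs_of_pos (inv_pos.2 Real.pi_pos), smul_eq_mul, inv_mul_eq_one₀ Real.pi_ne_zero] at hinv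
  exact hinv.symm

/-- The alternating binomial power sum `∑_{i < k} (-1)^i C(2k, i) (k - i)^q`. -/
def altBinomSum (k q : ℕ) : ℝ :=
  ∑ i ∈ Finset.range k, (-1 : ℝ) ^ i * (Nat.choose (2 * k) i) * ((k : ℝ) - i) ^ q

theorem altBinomSum_succ_add_two (k q : ℕ) :
    altBinomSum (k + 1) (q + 2) = ((k : ℝ) + 1) ^ 2 * altBinomSum (k + 1) q +
      (2 * k + 2) * (2 * k + 1) * altBinomSum k q := by
  have h : altBinomSum (k + 1) (q + 2) - ((k : ℝ) + 1) ^ 2 * altBinomSum (k + 1) q =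
      (2 * k + 2) * (2 * k + 1) * altBinomSum k q := by
    simp only [altBinomSum, Finset.mul_sum]
    rw [← Finset.sum_sub_distrib, Finset.sum_range_succ']
    simp only [Nat.cast_zero, Nat.cast_add, Nat.cast_one, sub_zero]
    refine (add_eq_left.2 (by ring)).trans (Finset.sum_congr rfl fun i hi ↦ ?_)
    have hi : i ≤ 2 * k + 1 := by have := Finset.mem_range.1 hi; omega
    have c1 : ((2 * k + 1 : ℕ) + 1 : ℝ) * Nat.choose (2 * k + 1) i =
        Nat.choose (2 * (k + 1)) (i + 1) * (i + 1) := by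
      exact_mod_cast Nat.add_one_mul_choose_eq (2 * k + 1) i
    have c2 : (Nat.choose (2 * k) i : ℝ) * ((2 * k : ℕ) + 1) =
        Nat.choose (2 * k + 1) i * ((2 * k + 1 : ℕ) - i) := by
      rw [← Nat.cast_sub hi]
      exact_mod_cast Nat.choose_mul_succ_eq (2 * k) i
    push_cast at c1 c2
    rw [add_sub_add_right_eq_sub, pow_add, pow_succ]
    linear_combination (-1 : ℝ) ^ i * ((k : ℝ) - i) ^ q *
      (-(2 * k + 1 - i) * c1 - (2 * k + 2) * c2)
  linarith

theorem sum_choose_mul_sin_sq {k : ℕ} (hk : 1 ≤ k) (x : ℝ) :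
    4 * ∑ i ∈ Finset.range k, (-1 : ℝ) ^ i * (Nat.choose (2 * k) i) *
      Real.sin (((k : ℝ) - i) * x) ^ 2 = -(-4) ^ k * Real.sin x ^ (2 * k) := by
  set F : ℕ → ℝ := fun i ↦ (-1 : ℝ) ^ i * (Nat.choose (2 * k) i) *
      Real.sin (((k : ℝ) - i) * x) ^ 2 with hF
  have hfold : ∑ i ∈ Finset.range (2 * k + 1), F i = 2 * ∑ i ∈ Finset.range k, F i := by
    rw [show 2 * k + 1 = k + (k + 1) by ring, Finset.sum_range_add, Finset.sum_range_succ',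
      ← Finset.sum_range_reflect (fun j ↦ F (k + (j + 1))) k]
    have h0 : F (k + 0) = 0 := by simp [hF]
    rw [h0, add_zero, two_mul]
    congr 1
    refine Finset.sum_congr rfl fun i hi ↦ ?_
    have hi := Finset.mem_range.1 hi
    have hj : k + (k - 1 - i + 1) = 2 * k - i := by omega
    simp only [hF]
    rw [hj, Nat.choose_symm (by omega), Nat.cast_sub (by omega)]
    have e1 : (-1 : ℝ) ^ (2 * k - i) = (-1) ^ i := by
      have h1 : (-1 : ℝ) ^ (2 * k - i) * (-1) ^ i = 1 := by
        rw [← pow_add, Nat.sub_add_cancel (by omega), (even_two_mul k).neg_one_pow]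
      have h2 : (-1 : ℝ) ^ i * (-1) ^ i = 1 := by rw [← mul_pow]; simp
      linear_combination (-1 : ℝ) ^ i * h1 - (-1 : ℝ) ^ (2 * k - i) * h2
    have e2 : ((k : ℝ) - ((2 * k : ℕ) - (i : ℝ))) * x = -(((k : ℝ) - i) * x) := by
      push_cast; ring
    rw [e1, e2, Real.sin_neg, neg_sq]
  suffices h : 4 * ∑ i ∈ Finset.range (2 * k + 1), F i = -2 * (-4) ^ k * Real.sin x ^ (2 * k) by
    rw [hfold] at h
    linarith
  set A : ℂ := Complex.exp (-x * Complex.I) with hA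
  set B : ℂ := Complex.exp (x * Complex.I) with hB
  have hterm : ∀ i ∈ Finset.range (2 * k + 1), (4 * F i : ℂ) =
      2 * ((-1) ^ i * 1 ^ (2 * k - i) * (Nat.choose (2 * k) i)) -
        (-A) ^ i * B ^ (2 * k - i) * (Nat.choose (2 * k) i) -
        (-B) ^ i * A ^ (2 * k - i) * (Nat.choose (2 * k) i) := by
    intro i hi
    have hi : i ≤ 2 * k := by have := Finset.mem_range.1 hi; omega
    have e1 : A ^ i * B ^ (2 * k - i) = Complex.exp (((k : ℂ) - i) * x * Complex.I) ^ 2 := by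
      rw [hA, hB, ← Complex.exp_nat_mul, ← Complex.exp_nat_mul, ← Complex.exp_nat_mul,
        ← Complex.exp_add, Nat.cast_sub hi]
      congr 1; push_cast; ring
    have e2 : B ^ i * A ^ (2 * k - i) = Complex.exp (-(((k : ℂ) - i) * x) * Complex.I) ^ 2 := by
      rw [hA, hB, ← Complex.exp_nat_mul, ← Complex.exp_nat_mul, ← Complex.exp_nat_mul,
        ← Complex.exp_add, Nat.cast_sub hi]
      congr 1; push_cast; ring
    have e3 : Complex.exp (-(((k : ℂ) - i) * x) * Complex.I) *
        Complex.exp (((k : ℂ) - i) * x * Complex.I) = 1 := by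
      rw [← Complex.exp_add]; simp
    rw [neg_pow A, neg_pow B, mul_assoc _ (A ^ i), mul_assoc _ (B ^ i), e1, e2, one_pow]
    simp only [hF]
    push_cast
    rw [Complex.sin]
    linear_combination (-1 : ℂ) ^ i * (Nat.choose (2 * k) i) * (2 * e3 +
      (Complex.exp (-(((k : ℂ) - i) * x) * Complex.I) -
        Complex.exp (((k : ℂ) - i) * x * Complex.I)) ^ 2 * Complex.I_sq)
  have hsin : (A - B) ^ 2 = -4 * Complex.sin x ^ 2 := by
    rw [Complex.sin, ← hA, ← hB]
    linear_combination (A - B) ^ 2 * Complex.I_sq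
  have hC : (4 * ∑ i ∈ Finset.range (2 * k + 1), (F i : ℂ)) =
      -2 * (-4) ^ k * Complex.sin x ^ (2 * k) := by
    rw [Finset.mul_sum, Finset.sum_congr rfl hterm, Finset.sum_sub_distrib,
      Finset.sum_sub_distrib, ← Finset.mul_sum, ← add_pow, ← add_pow, ← add_pow,
      pow_mul, pow_mul (-A + B), pow_mul (-B + A), pow_mul (Complex.sin _),
      show (-A + B) ^ 2 = (A - B) ^ 2 by ring, show (-B + A) ^ 2 = (A - B) ^ 2 by ring, hsin,
      mul_pow]
    have : k ≠ 0 := by omega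
    simp [this]
    ring
  exact_mod_cast hC

theorem integral_sin_mul_sq_div_sq {c : ℝ} (hc : 0 < c) :
    Integrable (fun x : ℝ ↦ Real.sin (c * x) ^ 2 / x ^ 2) ∧
      ∫ x : ℝ, Real.sin (c * x) ^ 2 / x ^ 2 = c * π := by
  have h : (fun x : ℝ ↦ Real.sin (c * x) ^ 2 / x ^ 2) =
      fun x ↦ c ^ 2 * (Real.sin (c * x) ^ 2 / (c * x) ^ 2) := by
    ext x
    rw [mul_pow]
    field_simp
  rw [h]
  refine ⟨((integrable_sin_pow_div_pow le_rfl le_rfl).comp_mul_left' hc.ne').const_mul _, ?_⟩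
  rw [integral_const_mul,
    Measure.integral_comp_mul_left (fun x : ℝ ↦ Real.sin x ^ 2 / x ^ 2) c,
    integral_sin_sq_div_sq, abs_of_pos (inv_pos.2 hc), smul_eq_mul]
  field_simp

theorem integral_sin_pow_div_sq {k : ℕ} (hk : 1 ≤ k) :
    ∫ x : ℝ, Real.sin x ^ (2 * k) / x ^ 2 = π * (-(1 / 4)) ^ (k - 1) * altBinomSum k 1 := by
  obtain ⟨d, rfl⟩ := Nat.exists_eq_add_of_le' hk
  have hpos : ∀ i ∈ Finset.range (d + 1), 0 < ((d + 1 : ℕ) : ℝ) - i := fun i hi ↦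
    sub_pos.2 (Nat.cast_lt.2 (Finset.mem_range.1 hi))
  have h : ∀ x : ℝ, Real.sin x ^ (2 * (d + 1)) / x ^ 2 = ∑ i ∈ Finset.range (d + 1),
      (-(1 / 4)) ^ d * ((-1 : ℝ) ^ i * (Nat.choose (2 * (d + 1)) i)) *
        (Real.sin ((((d + 1 : ℕ) : ℝ) - i) * x) ^ 2 / x ^ 2) := by
    intro x
    have h1 := sum_choose_mul_sin_sq hk x
    have h2 : (-(1 / 4) : ℝ) ^ d * (-4) ^ d = 1 := by rw [← mul_pow]; norm_num
    have h3 : Real.sin x ^ (2 * (d + 1)) = (-(1 / 4)) ^ d * ∑ i ∈ Finset.range (d + 1),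
        (-1 : ℝ) ^ i * (Nat.choose (2 * (d + 1)) i) *
          Real.sin ((((d + 1 : ℕ) : ℝ) - i) * x) ^ 2 := by
      linear_combination (-(1 / 4) : ℝ) ^ d * (-1 / 4) * h1 - Real.sin x ^ (2 * (d + 1)) * h2
    rw [h3, Finset.mul_sum, Finset.sum_div]
    exact Finset.sum_congr rfl fun i _ ↦ by ring
  simp_rw [h]
  rw [integral_finsetSum _ fun i hi ↦ (integral_sin_mul_sq_div_sq (hpos i hi)).1.const_mul _,
    altBinomSum, Finset.mul_sum]
  refine Finset.sum_congr rfl fun i hi ↦ ?_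
  rw [integral_const_mul, (integral_sin_mul_sq_div_sq (hpos i hi)).2, Nat.add_sub_cancel]
  ring

theorem tendsto_div_pow_atTop_zero {f : ℝ → ℝ} (hf : ∀ x, |f x| ≤ 1) {m : ℕ} (hm : m ≠ 0) :
    Filter.Tendsto (fun x ↦ f x / x ^ m) Filter.atTop (nhds 0) := by
  refine squeeze_zero_norm' ?_ (tendsto_inv_atTop_zero.comp (Filter.tendsto_pow_atTop hm))
  filter_upwards [Filter.eventually_gt_atTop 0] with x hx
  rw [Real.norm_eq_abs, abs_div, abs_of_pos (pow_pos hx m), div_eq_mul_inv, Function.comp]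
  exact mul_le_of_le_one_left (by positivity) (hf x)

theorem integral_sin_pow_div_pow_recurrence {k q : ℕ} (hq : 1 ≤ q) (h : q ≤ k) :
    (2 * q + 1) * (2 * q) * ∫ x : ℝ, Real.sin x ^ (2 * (k + 1)) / x ^ (2 * (q + 1)) =
      (2 * k + 2) * (2 * k + 1) * (∫ x : ℝ, Real.sin x ^ (2 * k) / x ^ (2 * q)) -
        (2 * k + 2) ^ 2 * ∫ x : ℝ, Real.sin x ^ (2 * (k + 1)) / x ^ (2 * q) := by
  have i1 : Integrable fun x : ℝ ↦ Real.sin x ^ (2 * (k + 1)) / x ^ (2 * (q + 1)) :=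
    integrable_sin_pow_div_pow (by omega) (by omega)
  have i2 : Integrable fun x : ℝ ↦ Real.sin x ^ (2 * k) / x ^ (2 * q) :=
    integrable_sin_pow_div_pow (by omega) (by omega)
  have i3 : Integrable fun x : ℝ ↦ Real.sin x ^ (2 * (k + 1)) / x ^ (2 * q) :=
    integrable_sin_pow_div_pow (by omega) (by omega)
  set D : ℝ → ℝ := fun x ↦
    (2 * q + 1) * (2 * q) * (Real.sin x ^ (2 * (k + 1)) / x ^ (2 * (q + 1))) -
      ((2 * k + 2) * (2 * k + 1) * (Real.sin x ^ (2 * k) / x ^ (2 * q)) -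
        (2 * k + 2) ^ 2 * (Real.sin x ^ (2 * (k + 1)) / x ^ (2 * q))) with hD
  have i23 : Integrable fun x : ℝ ↦
      (2 * k + 2) * (2 * k + 1) * (Real.sin x ^ (2 * k) / x ^ (2 * q)) -
        (2 * k + 2) ^ 2 * (Real.sin x ^ (2 * (k + 1)) / x ^ (2 * q)) :=
    (i2.const_mul _).sub (i3.const_mul _)
  have iD : Integrable D := (i1.const_mul _).sub i23
  have habs : ∀ x, D |x| = D x := by
    intro x
    have hs : ∀ m, Real.sin |x| ^ (2 * m) = Real.sin x ^ (2 * m) := by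
      intro m
      rcases abs_choice x with h | h <;> simp [h, pow_mul]
    simp only [hD, hs, (even_two_mul _).pow_abs]
  set G : ℝ → ℝ := fun x ↦ -(2 * q) * (Real.sin x ^ (2 * k + 2) / x ^ (2 * q + 1)) -
    (2 * k + 2) * (Real.sin x ^ (2 * k + 1) / x ^ (2 * q) * Real.cos x) with hG
  have hGcont : Continuous G := by
    have e1 := fun x ↦ sin_pow_div_pow_eq_mul_sinc (show 2 * q + 1 < 2 * k + 2 by omega) x
    have e2 := fun x ↦ sin_pow_div_pow_eq_mul_sinc (show 2 * q < 2 * k + 1 by omega) x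
    simp only [hG, e1, e2]
    have := Real.continuous_sinc
    fun_prop
  have hG0 : G 0 = 0 := by simp [hG]
  have hGtop : Filter.Tendsto G Filter.atTop (nhds 0) := by
    have t1 := tendsto_div_pow_atTop_zero (f := fun x ↦ Real.sin x ^ (2 * k + 2))
      (fun x ↦ by rw [abs_pow]; exact pow_le_one₀ (abs_nonneg _) (Real.abs_sin_le_one x))
      (show 2 * q + 1 ≠ 0 by omega)
    have t2 := tendsto_div_pow_atTop_zero (f := fun x ↦ Real.sin x ^ (2 * k + 1) * Real.cos x)
      (fun x ↦ by
        rw [abs_mul, abs_pow]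
        exact mul_le_one₀ (pow_le_one₀ (abs_nonneg _) (Real.abs_sin_le_one x))
          (abs_nonneg _) (Real.abs_cos_le_one x))
      (show 2 * q ≠ 0 by omega)
    have := (t1.const_mul (-(2 * q : ℝ))).sub (t2.const_mul (2 * k + 2 : ℝ))
    simp only [mul_zero, sub_zero] at this
    refine this.congr fun x ↦ ?_
    simp only [hG, div_mul_eq_mul_div]
  have hderiv : ∀ x ∈ Set.Ioi (0 : ℝ), HasDerivAt G (D x) x := by
    intro x hx
    have hx0 : x ≠ 0 := ne_of_gt hx
    have hs := Real.hasDerivAt_sin x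
    have d1 := (hs.pow (2 * k + 2)).div (hasDerivAt_pow (2 * q + 1) x) (pow_ne_zero _ hx0)
    have d2 := ((hs.pow (2 * k + 1)).div (hasDerivAt_pow (2 * q) x) (pow_ne_zero _ hx0)).mul
      (Real.hasDerivAt_cos x)
    convert! (d1.const_mul (-(2 * q : ℝ))).sub (d2.const_mul (2 * k + 2 : ℝ)) using 1
    obtain ⟨r, rfl⟩ := Nat.exists_eq_add_of_le' hq
    simp only [hD, show 2 * (r + 1) - 1 = 2 * r + 1 by omega, Nat.add_sub_cancel,
      show 2 * k + 2 - 1 = 2 * k + 1 by omega, Pi.pow_apply, Pi.div_apply]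
    push_cast
    field_simp
    have hc : Real.cos x ^ 2 = 1 - Real.sin x ^ 2 := Real.cos_sq' x
    ring_nf
    rw [hc]
    ring
  have hintg : ∫ x, D x = 0 := by
    rw [← integral_congr_ae (Filter.Eventually.of_forall habs), integral_comp_abs (f := D),
      integral_Ioi_of_hasDerivAt_of_tendsto hGcont.continuousWithinAt hderiv iD.integrableOn
        hGtop, hG0]
    simp
  simp only [hD] at hintg
  rw [integral_sub (i1.const_mul _) i23,
    integral_sub (i2.const_mul _) (i3.const_mul _), integral_const_mul, integral_const_mul,
    integral_const_mul] at hintg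
  linarith

theorem integral_sin_pow_div_pow (p d : ℕ) :
    ∫ x : ℝ, Real.sin x ^ (2 * (p + 1 + d)) / x ^ (2 * (p + 1)) =
      π * (-(1 / 4)) ^ d / (Nat.factorial (2 * p + 1)) * altBinomSum (p + 1 + d) (2 * p + 1) := by
  induction p generalizing d with
  | zero =>
    have := integral_sin_pow_div_sq (k := 0 + 1 + d) (by omega)
    rw [show 0 + 1 + d - 1 = d by omega] at this
    simpa using this
  | succ p ih =>
    have h := integral_sin_pow_div_pow_recurrence (k := p + 1 + d) (q := p + 1) (by omega)
      (by omega)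
    have e : p + 1 + d + 1 = p + 1 + (d + 1) := by ring
    have ih2 := ih (d + 1)
    rw [← e] at ih2
    rw [ih d, ih2] at h
    have hS := altBinomSum_succ_add_two (p + 1 + d) (2 * p + 1)
    rw [show p + 1 + 1 + d = p + 1 + d + 1 by ring, show 2 * (p + 1) + 1 = 2 * p + 1 + 2 by ring,
      hS, Nat.factorial_succ, Nat.factorial_succ]
    have hf : (Nat.factorial (2 * p + 1) : ℝ) ≠ 0 := by positivity
    have hp : ((2 * (p + 1) + 1) * (2 * (p + 1)) : ℝ) ≠ 0 := by positivity
    push_cast at h ⊢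
    refine mul_left_cancel₀ hp (h.trans ?_)
    field_simp
    ring

/-- The part in powers of `u` of the partial fraction expansion of `u ^ a * v ^ b`, where
`u * v = c * (u - v)`. -/
def partialFractionSum (a b : ℕ) (c u : ℝ) : ℝ :=
  ∑ l ∈ Finset.range a, (Nat.choose (l + b - 1) l : ℝ) * c ^ b * (-c) ^ l * u ^ (a - l)

theorem partialFractionSum_succ_succ (a b : ℕ) (c u : ℝ) :
    partialFractionSum (a + 1) (b + 1) c u =
      c * (partialFractionSum (a + 1) b c u - partialFractionSum a (b + 1) c u) := by
  simp only [partialFractionSum]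
  rw [Finset.sum_range_succ', Finset.sum_range_succ' _ a, add_sub_right_comm,
    ← Finset.sum_sub_distrib, mul_add, Finset.mul_sum]
  congr 1
  · refine Finset.sum_congr rfl fun l _ ↦ ?_
    rw [show l + 1 + (b + 1) - 1 = (l + b) + 1 by omega, show l + 1 + b - 1 = l + b by omega,
      show l + (b + 1) - 1 = l + b by omega, Nat.choose_succ_succ, Nat.add_sub_add_right]
    push_cast
    ring
  · simp
    ring

theorem partialFractionSum_succ_zero (a : ℕ) (c u : ℝ) :
    partialFractionSum (a + 1) 0 c u = u ^ (a + 1) := by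
  rw [partialFractionSum, Finset.sum_range_succ', Finset.sum_eq_zero]
  · simp
  · intro l _
    rw [Nat.choose_eq_zero_of_lt (by omega)]
    simp

theorem pow_mul_pow_eq_partialFractionSum {c u v : ℝ} (h : u * v = c * (u - v)) (a b : ℕ)
    (hab : 1 ≤ a + b) :
    u ^ a * v ^ b = partialFractionSum a b c u + partialFractionSum b a (-c) v := by
  induction a generalizing b with
  | zero =>
    obtain ⟨d, rfl⟩ := Nat.exists_eq_add_of_le' (show 1 ≤ b by omega)
    rw [partialFractionSum_succ_zero]
    simp [partialFractionSum]
  | succ a iha =>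
    induction b with
    | zero =>
      rw [partialFractionSum_succ_zero]
      simp [partialFractionSum]
    | succ b ihb =>
      rw [partialFractionSum_succ_succ, partialFractionSum_succ_succ]
      linear_combination c * ihb (by omega) - c * iha (b + 1) (by omega) + u ^ a * v ^ b * h

theorem integral_sub_shift_eq_zero {g : ℝ → ℝ} (hg : Continuous g)
    (htop : Filter.Tendsto g Filter.atTop (nhds 0)) (hbot : Filter.Tendsto g Filter.atBot (nhds 0))
    {N : ℝ} (hN : 0 ≤ N) (hintg : Integrable fun x ↦ g (x + N) - g x) :
    ∫ x, (g (x + N) - g x) = 0 := by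
  have hi : ∀ a b, IntervalIntegrable g volume a b := fun a b ↦ hg.intervalIntegrable a b
  have hderiv : ∀ x, HasDerivAt (fun x ↦ ∫ t in x..(x + N), g t) (g (x + N) - g x) x := by
    intro x
    have h1 : ∀ y, HasDerivAt (fun u ↦ ∫ t in (0 : ℝ)..u, g t) (g y) y := fun y ↦
      hg.integral_hasStrictDerivAt 0 y |>.hasDerivAt
    have h2 := ((h1 (x + N)).comp_add_const x N).sub (h1 x)
    refine h2.congr_of_eventuallyEq (Filter.Eventually.of_forall fun y ↦ ?_)
    exact (intervalIntegral.integral_interval_sub_left (hi _ _) (hi _ _)).symm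
  have key : ∀ {l : Filter ℝ}, (∀ ε > 0, ∀ᶠ x in l, ∀ t ∈ Set.Icc x (x + N), ‖g t‖ ≤ ε) →
      Filter.Tendsto (fun x ↦ ∫ t in x..(x + N), g t) l (nhds 0) := by
    intro l hl
    rw [Metric.tendsto_nhds]
    intro ε hε
    filter_upwards [hl (ε / (N + 1)) (by positivity)] with x hx
    rw [dist_zero_right]
    have := intervalIntegral.norm_integral_le_of_norm_le_const (a := x) (b := x + N) (f := g)
      (C := ε / (N + 1)) fun t ht ↦ by
        rw [Set.uIoc_of_le (by linarith)] at ht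
        exact hx t (Set.Ioc_subset_Icc_self ht)
    refine this.trans_lt ?_
    rw [add_sub_cancel_left, abs_of_nonneg hN, div_mul_eq_mul_div, div_lt_iff₀ (by positivity)]
    nlinarith
  have hclose : ∀ {l : Filter ℝ}, Filter.Tendsto g l (nhds 0) → ∀ ε > 0, ∀ᶠ x in l, ‖g x‖ ≤ ε := by
    intro l h ε hε
    filter_upwards [Metric.tendsto_nhds.1 h ε hε] with x hx
    rw [dist_zero_right] at hx
    exact hx.le
  rw [integral_of_hasDerivAt_of_tendsto hderiv hintg (m := 0) (n := 0), sub_zero]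
  · refine key fun ε hε ↦ ?_
    obtain ⟨M, hM⟩ := Filter.eventually_atBot.1 (hclose hbot ε hε)
    filter_upwards [Filter.eventually_le_atBot (M - N)] with x hx t ht
    exact hM t (by linarith [ht.2])
  · refine key fun ε hε ↦ ?_
    obtain ⟨M, hM⟩ := Filter.eventually_atTop.1 (hclose htop ε hε)
    filter_upwards [Filter.eventually_ge_atTop M] with x hx t ht
    exact hM t (by linarith [ht.1])

theorem ae_ne_and_add_ne (N : ℝ) : ∀ᵐ x : ℝ, x ≠ 0 ∧ x + N ≠ 0 := by
  filter_upwards [compl_mem_ae_iff.2 (measure_singleton (0 : ℝ)),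
    compl_mem_ae_iff.2 (measure_singleton (-N))] with x h1 h2
  exact ⟨h1, fun h ↦ h2 (eq_neg_of_add_eq_zero_left h)⟩

theorem sin_add_nat_mul_pi_pow_even (n k : ℕ) (x : ℝ) :
    Real.sin (x + n * π) ^ (2 * k) = Real.sin x ^ (2 * k) := by
  rw [Real.sin_add_nat_mul_pi, mul_pow, ← pow_mul, mul_left_comm, pow_mul]
  simp

theorem integrable_sin_pow_div_shift_sub (n : ℕ) {k : ℕ} (hk : 1 ≤ k) :
    Integrable fun x : ℝ ↦ Real.sin (x + n * π) ^ (2 * k) / (x + n * π) ^ 1 -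
      Real.sin x ^ (2 * k) / x ^ 1 := by
  have h1 : Integrable fun x : ℝ ↦ Real.sin x ^ (2 * k) / x ^ 2 :=
    integrable_sin_pow_div_pow le_rfl (by omega)
  refine ((h1.add (h1.comp_add_right (n * π))).const_mul (n * π)).mono'
    (Measurable.aestronglyMeasurable (by fun_prop)) ?_
  filter_upwards [ae_ne_and_add_ne (n * π)] with x ⟨hx, hy⟩
  simp only [sin_add_nat_mul_pi_pow_even, Pi.add_apply]
  have hN : (0 : ℝ) ≤ n * π := by positivity
  have hS : 0 ≤ Real.sin x ^ (2 * k) := (even_two_mul k).pow_nonneg _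
  generalize Real.sin x ^ (2 * k) = S at *
  generalize (n * π : ℝ) = N at *
  have e : S / (x + N) ^ 1 - S / x ^ 1 = -(S * N * (x⁻¹ * (x + N)⁻¹)) := by
    field_simp; ring
  rw [e, norm_neg, Real.norm_eq_abs, abs_mul, abs_of_nonneg (mul_nonneg hS hN)]
  have h2 : |x⁻¹ * (x + N)⁻¹| ≤ (x⁻¹) ^ 2 + ((x + N)⁻¹) ^ 2 := by
    rw [abs_le]
    constructor <;> nlinarith [sq_nonneg (x⁻¹ + (x + N)⁻¹), sq_nonneg (x⁻¹ - (x + N)⁻¹),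
      sq_nonneg x⁻¹, sq_nonneg (x + N)⁻¹]
  calc S * N * |x⁻¹ * (x + N)⁻¹| ≤ S * N * ((x⁻¹) ^ 2 + ((x + N)⁻¹) ^ 2) := by gcongr
    _ = N * (S / x ^ 2 + S / (x + N) ^ 2) := by
      rw [inv_pow, inv_pow]; ring

theorem integral_sin_pow_div_shift_sub (n : ℕ) {k : ℕ} (hk : 1 ≤ k) :
    ∫ x : ℝ, (Real.sin (x + n * π) ^ (2 * k) / (x + n * π) ^ 1 -
      Real.sin x ^ (2 * k) / x ^ 1) = 0 := by
  have htop := tendsto_div_pow_atTop_zero (f := fun x ↦ Real.sin x ^ (2 * k))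
    (fun x ↦ by rw [abs_pow]; exact pow_le_one₀ (abs_nonneg _) (Real.abs_sin_le_one x))
    one_ne_zero
  refine integral_sub_shift_eq_zero (g := fun x ↦ Real.sin x ^ (2 * k) / x ^ 1) ?_ htop ?_
    (by positivity) (integrable_sin_pow_div_shift_sub n hk)
  · simp only [fun x ↦ sin_pow_div_pow_eq_mul_sinc (show 1 < 2 * k by omega) x]
    have := Real.continuous_sinc
    fun_prop
  · have := (htop.comp Filter.tendsto_neg_atBot_atTop).neg
    rw [neg_zero] at this
    refine this.congr fun x ↦ ?_
    simp [pow_mul, div_neg]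

theorem integral_sin_pow_div_pow_add_shift (n : ℕ) {k l : ℕ} (hl : l < 2 * k) :
    Integrable (fun x : ℝ ↦ (-1) ^ l * (Real.sin x ^ (2 * k) / x ^ (2 * k - l)) +
        Real.sin (x + n * π) ^ (2 * k) / (x + n * π) ^ (2 * k - l)) ∧
      ∫ x : ℝ, ((-1) ^ l * (Real.sin x ^ (2 * k) / x ^ (2 * k - l)) +
        Real.sin (x + n * π) ^ (2 * k) / (x + n * π) ^ (2 * k - l)) =
      ((-1) ^ l + 1) * ∫ x : ℝ, Real.sin x ^ (2 * k) / x ^ (2 * k - l) := by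
  rcases (show 2 * k - l = 1 ∨ 2 ≤ 2 * k - l by omega) with h | h
  · have hodd : (-1 : ℝ) ^ l = -1 := Odd.neg_one_pow ⟨k - 1, by omega⟩
    simp only [h, hodd, neg_one_mul, neg_add_eq_sub, sub_self, zero_mul]
    exact ⟨integrable_sin_pow_div_shift_sub n (by omega),
      integral_sin_pow_div_shift_sub n (by omega)⟩
  · have hi : Integrable fun x : ℝ ↦ Real.sin x ^ (2 * k) / x ^ (2 * k - l) :=
      integrable_sin_pow_div_pow h (Nat.sub_le _ _)
    have hi' := hi.comp_add_right (n * π)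
    refine ⟨(hi.const_mul _).add hi', ?_⟩
    rw [integral_add (hi.const_mul _) hi', integral_const_mul, integral_add_right_eq_self
      (fun x : ℝ ↦ Real.sin x ^ (2 * k) / x ^ (2 * k - l)) (n * π)]
    ring

theorem sum_range_two_mul_neg_one_pow_add_one (f : ℕ → ℝ) (k : ℕ) :
    ∑ l ∈ Finset.range (2 * k), ((-1) ^ l + 1) * f l = ∑ j ∈ Finset.range k, 2 * f (2 * j) := by
  induction k with
  | zero => simp
  | succ k ih =>
    rw [show 2 * (k + 1) = 2 * k + 1 + 1 by ring, Finset.sum_range_succ, Finset.sum_range_succ,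
      Finset.sum_range_succ, ih, pow_succ, (even_two_mul k).neg_one_pow]
    ring

theorem sin_sq_div_sq_pow_eq_sum {n : ℕ} (hn : 1 ≤ n) {k : ℕ} (hk : 1 ≤ k) {x : ℝ} (hx : x ≠ 0)
    (hy : x + n * π ≠ 0) :
    (Real.sin x ^ 2 / (x * (x + n * π)) ^ 2) ^ k = ∑ l ∈ Finset.range (2 * k),
      (Nat.choose (l + 2 * k - 1) l * ((n * π)⁻¹ ^ (2 * k) * (n * π)⁻¹ ^ l)) *
        ((-1) ^ l * (Real.sin x ^ (2 * k) / x ^ (2 * k - l)) +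
          Real.sin (x + n * π) ^ (2 * k) / (x + n * π) ^ (2 * k - l)) := by
  have hN : (n * π : ℝ) ≠ 0 := by positivity
  have hpf := pow_mul_pow_eq_partialFractionSum (c := (n * π : ℝ)⁻¹) (u := x⁻¹)
    (v := (x + n * π)⁻¹) (by field_simp; ring) (2 * k) (2 * k) (by omega)
  have h0 : (Real.sin x ^ 2 / (x * (x + n * π)) ^ 2) ^ k =
      Real.sin x ^ (2 * k) * (x⁻¹ ^ (2 * k) * (x + n * π)⁻¹ ^ (2 * k)) := by
    rw [div_pow, ← pow_mul, ← pow_mul, mul_pow, inv_pow, inv_pow, ← mul_inv, div_eq_mul_inv]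
  rw [h0, hpf, partialFractionSum, partialFractionSum, ← Finset.sum_add_distrib, Finset.mul_sum]
  refine Finset.sum_congr rfl fun l _ ↦ ?_
  rw [sin_add_nat_mul_pi_pow_even, neg_neg, (even_two_mul k).neg_pow, neg_pow _ l]
  simp only [inv_pow, div_eq_mul_inv]
  ring

theorem Ink_closed_form (n k : ℕ) (hn : 1 ≤ n) (hk : 1 ≤ k) :
    ∫ t : ℝ, (Real.sin (t - π * n / 2) ^ 2 / (t ^ 2 - π ^ 2 * n ^ 2 / 4) ^ 2) ^ k =
      ((π * n) ^ (2 * k))⁻¹ *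
        ∑ j ∈ Finset.range k,
          (Nat.choose (2 * j + 2 * k - 1) (2 * k - 1)) *
            (2 * π * ((π * n) ^ (2 * j))⁻¹ * (-(1 / 4 : ℝ)) ^ j /
              (Nat.factorial (2 * k - 2 * j - 1))) *
            ∑ i ∈ Finset.range k,
              (-1 : ℝ) ^ i * (Nat.choose (2 * k) i) * ((k : ℝ) - i) ^ (2 * k - 2 * j - 1) := by
  have hshift : ∀ t : ℝ, t ^ 2 - π ^ 2 * n ^ 2 / 4 =
      (t - π * n / 2) * (t - π * n / 2 + n * π) := fun t ↦ by ring
  simp_rw [hshift]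
  rw [integral_sub_right_eq_self
    (fun x : ℝ ↦ (Real.sin x ^ 2 / (x * (x + n * π)) ^ 2) ^ k) (π * n / 2)]
  have hae := (ae_ne_and_add_ne (n * π)).mono fun x hx ↦ sin_sq_div_sq_pow_eq_sum hn hk hx.1 hx.2
  rw [integral_congr_ae hae, integral_finsetSum _ fun l hl ↦
    (integral_sin_pow_div_pow_add_shift n (Finset.mem_range.1 hl)).1.const_mul _]
  have hterm : ∀ l ∈ Finset.range (2 * k), ∫ x : ℝ,
      (Nat.choose (l + 2 * k - 1) l * ((n * π)⁻¹ ^ (2 * k) * (n * π)⁻¹ ^ l)) *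
        ((-1) ^ l * (Real.sin x ^ (2 * k) / x ^ (2 * k - l)) +
          Real.sin (x + n * π) ^ (2 * k) / (x + n * π) ^ (2 * k - l)) =
      ((-1) ^ l + 1) * ((Nat.choose (l + 2 * k - 1) l *
        ((n * π)⁻¹ ^ (2 * k) * (n * π)⁻¹ ^ l)) *
          ∫ x : ℝ, Real.sin x ^ (2 * k) / x ^ (2 * k - l)) := by
    intro l hl
    rw [integral_const_mul, (integral_sin_pow_div_pow_add_shift n (Finset.mem_range.1 hl)).2]
    ring
  rw [Finset.sum_congr rfl hterm, sum_range_two_mul_neg_one_pow_add_one, Finset.mul_sum]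
  refine Finset.sum_congr rfl fun j hj ↦ ?_
  have hj := Finset.mem_range.1 hj
  have hJ := integral_sin_pow_div_pow (k - 1 - j) j
  rw [show k - 1 - j + 1 + j = k by omega, show 2 * (k - 1 - j + 1) = 2 * k - 2 * j by omega,
    show 2 * (k - 1 - j) + 1 = 2 * k - 2 * j - 1 by omega, altBinomSum] at hJ
  rw [hJ, Nat.choose_symm_of_eq_add (show 2 * j + 2 * k - 1 = 2 * j + (2 * k - 1) by omega),
    inv_pow, inv_pow, mul_comm (n : ℝ) π]
  ring
end

section
/- For every positive integer n, the integral ∫_{-∞}^{∞} sin²(t - πn/2) / (t² - π²n²/4)² dt equals 2/(π n²). -/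
open Real MeasureTheory

/-- Unfolding: if the integer translates of a nonnegative function on the line sum to the constant
`c` almost everywhere, then its integral is `c`. -/
theorem integral_eq_of_ae_hasSum_add_intCast {f : ℝ → ℝ} {c : ℝ} (hf : Measurable f)
    (hf₀ : ∀ x, 0 ≤ f x) (hc : 0 ≤ c)
    (h : ∀ᵐ x : ℝ, HasSum (fun k : ℤ => f (x + k)) c) : ∫ x, f x = c := by
  have hunion : ∫⁻ x, ENNReal.ofReal (f x) =
      ∑' k : ℤ, ∫⁻ x in Set.Ioc (k : ℝ) (k + 1), ENNReal.ofReal (f x) := by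
    rw [← setLIntegral_univ, ← iUnion_Ioc_intCast (α := ℝ)]
    exact lintegral_iUnion (fun _ => measurableSet_Ioc) (Set.pairwise_disjoint_Ioc_intCast ℝ) _
  have htrans (k : ℤ) : ∫⁻ x in Set.Ioc (k : ℝ) (k + 1), ENNReal.ofReal (f x) =
      ∫⁻ x in Set.Ioc (0 : ℝ) 1, ENNReal.ofReal (f (x + k)) := by
    rw [(measurePreserving_add_right volume (k : ℝ)).setLIntegral_comp_emb
      (measurableEmbedding_addRight (k : ℝ)) (fun x => ENNReal.ofReal (f x))]
    simp [add_comm]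
  rw [integral_eq_lintegral_of_nonneg_ae (.of_forall hf₀) hf.aestronglyMeasurable, hunion]
  simp_rw [htrans]
  rw [← lintegral_tsum (fun k => by fun_prop)]
  have hconst : ∫⁻ x in Set.Ioc (0 : ℝ) 1, ∑' k : ℤ, ENNReal.ofReal (f (x + k)) =
      ∫⁻ _ in Set.Ioc (0 : ℝ) 1, ENNReal.ofReal c := by
    refine lintegral_congr_ae (ae_restrict_of_ae ?_)
    filter_upwards [h] with x hx
    rw [← ENNReal.ofReal_tsum_of_nonneg (fun _ => hf₀ _) hx.summable, hx.tsum_eq]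
  rw [hconst]
  simp [hc]

theorem fourierCoeffOn_exp_sub_exp {θ : ℝ} (n k : ℤ) (h₁ : θ - k ≠ 0) (h₂ : θ + n - k ≠ 0) :
    fourierCoeffOn zero_lt_one (fun x : ℝ =>
        Complex.exp (2 * π * Complex.I * θ * x) - Complex.exp (2 * π * Complex.I * (θ + n) * x)) k =
      (Complex.exp (Complex.I * ((2 * π * (θ - k) : ℝ) : ℂ)) - 1) * n /
        (2 * π * Complex.I * ((θ - k) * (θ + n - k))) := by
  have h₁' : (θ - k : ℂ) ≠ 0 := by exact_mod_cast h₁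
  have h₂' : (θ + n - k : ℂ) ≠ 0 := by exact_mod_cast h₂
  have hπ : (π : ℂ) ≠ 0 := by exact_mod_cast pi_ne_zero
  have hint (x : ℝ) : fourier (-k) (x : AddCircle ((1 : ℝ) - 0)) •
      (Complex.exp (2 * π * Complex.I * θ * x) - Complex.exp (2 * π * Complex.I * (θ + n) * x)) =
      Complex.exp (2 * π * Complex.I * (θ - k) * x) -
        Complex.exp (2 * π * Complex.I * (θ + n - k) * x) := by
    rw [fourier_coe_apply, smul_eq_mul, mul_sub, ← Complex.exp_add, ← Complex.exp_add]
    push_cast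
    congr 2 <;> ring
  have hexp : Complex.exp (2 * π * Complex.I * (θ + n - k)) =
      Complex.exp (2 * π * Complex.I * (θ - k)) := by
    rw [← Complex.exp_periodic.int_mul n (2 * π * Complex.I * (θ - k))]
    congr 1
    ring
  rw [fourierCoeffOn_eq_integral]
  simp_rw [hint]
  rw [intervalIntegral.integral_sub
      (Continuous.intervalIntegrable (by fun_prop) _ _)
      (Continuous.intervalIntegrable (by fun_prop) _ _),
    integral_exp_mul_complex (by simp [h₁', hπ]), integral_exp_mul_complex (by simp [h₂', hπ])]
  simp only [Complex.ofReal_one, Complex.ofReal_zero, mul_one, mul_zero, Complex.exp_zero, hexp]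
  rw [show Complex.I * ((2 * π * (θ - k) : ℝ) : ℂ) = 2 * π * Complex.I * (θ - k) by
    push_cast; ring]
  have hI := Complex.I_ne_zero
  simp only [sub_zero, div_one, one_smul]
  field_simp
  ring

theorem norm_sq_exp_I_mul_sub_one (x : ℝ) :
    ‖Complex.exp (Complex.I * ((2 * x : ℝ) : ℂ)) - 1‖ ^ 2 = 4 * sin x ^ 2 := by
  rw [Complex.norm_exp_I_mul_ofReal_sub_one, norm_eq_abs, sq_abs,
    mul_div_cancel_left₀ x two_ne_zero]
  ring

theorem intervalIntegral_norm_sq_exp_sub_exp (θ : ℝ) {n : ℤ} (hn : n ≠ 0) :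
    ∫ x in (0 : ℝ)..1, ‖Complex.exp (2 * π * Complex.I * θ * x) -
      Complex.exp (2 * π * Complex.I * (θ + n) * x)‖ ^ 2 = 2 := by
  have hnorm (x : ℝ) : ‖Complex.exp (2 * π * Complex.I * θ * x) -
      Complex.exp (2 * π * Complex.I * (θ + n) * x)‖ ^ 2 = 4 * sin (π * n * x) ^ 2 := by
    rw [← norm_sq_exp_I_mul_sub_one, norm_sub_rev,
      show Complex.exp (2 * π * Complex.I * (θ + n) * x) -
          Complex.exp (2 * π * Complex.I * θ * x) =
        Complex.exp ((2 * π * θ * x : ℝ) * Complex.I) *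
          (Complex.exp (Complex.I * ((2 * (π * n * x) : ℝ) : ℂ)) - 1) by
        rw [mul_sub, ← Complex.exp_add, mul_one]
        push_cast
        congr 2 <;> ring,
      norm_mul, Complex.norm_exp_ofReal_mul_I, one_mul]
  have hn' : (n : ℝ) ≠ 0 := by exact_mod_cast hn
  have hπn : π * n ≠ 0 := mul_ne_zero pi_ne_zero hn'
  simp_rw [hnorm]
  rw [intervalIntegral.integral_const_mul,
    intervalIntegral.integral_comp_mul_left (fun y => sin y ^ 2) hπn, integral_sin_sq]
  simp only [mul_zero, mul_one, sin_zero, mul_comm π (n : ℝ), sin_int_mul_pi, smul_eq_mul]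
  field_simp
  ring

theorem hasSum_sin_sq_div_sq {θ : ℝ} (hθ : θ ∉ Set.range ((↑) : ℤ → ℝ)) {n : ℤ} (hn : n ≠ 0) :
    HasSum (fun k : ℤ => sin (π * (θ + k)) ^ 2 / ((θ + k) * (θ + k + n)) ^ 2)
      (2 * π ^ 2 / n ^ 2) := by
  have hcont : Continuous fun x : ℝ => Complex.exp (2 * π * Complex.I * θ * x) -
      Complex.exp (2 * π * Complex.I * (θ + n) * x) := by fun_prop
  have hL2 : MemLp (fun x : ℝ => Complex.exp (2 * π * Complex.I * θ * x) -
      Complex.exp (2 * π * Complex.I * (θ + n) * x)) 2 (volume.restrict (Set.Ioc 0 1)) := by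
    rw [memLp_two_iff_integrable_sq_norm hcont.aestronglyMeasurable]
    exact (hcont.norm.pow 2).integrableOn_Ioc
  have key := hasSum_sq_fourierCoeffOn zero_lt_one hL2
  rw [intervalIntegral_norm_sq_exp_sub_exp θ hn, ← (Equiv.neg ℤ).hasSum_iff] at key
  have hn' : (n : ℝ) ≠ 0 := by exact_mod_cast hn
  rw [show 2 * π ^ 2 / (n : ℝ) ^ 2 = π ^ 2 / n ^ 2 * (((1 : ℝ) - 0)⁻¹ • 2) by
    simp only [sub_zero, inv_one, one_smul]
    ring]
  refine (key.mul_left (π ^ 2 / n ^ 2 : ℝ)).congr_fun fun k => ?_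
  have h₁ : θ - (-k : ℤ) ≠ 0 := fun h => hθ ⟨-k, by linarith⟩
  have h₂ : θ + n - (-k : ℤ) ≠ 0 := fun h => hθ ⟨-k - n, by push_cast at h ⊢; linarith⟩
  have hden : ‖((θ : ℂ) - (-k : ℤ)) * (θ + n - (-k : ℤ))‖ ^ 2 =
      ((θ + k) * (θ + k + n)) ^ 2 := by
    rw [show ((θ : ℂ) - (-k : ℤ)) * (θ + n - (-k : ℤ)) =
      (((θ + k) * (θ + k + n) : ℝ) : ℂ) by push_cast; ring, Complex.norm_real, norm_eq_abs,
      sq_abs]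
  simp only [Function.comp_apply, Equiv.neg_apply]
  rw [fourierCoeffOn_exp_sub_exp n (-k) h₁ h₂, norm_div, norm_mul, norm_mul _ (_ * _), div_pow,
    mul_pow ‖_‖ ‖_‖, mul_pow ‖_‖ ‖_‖, hden, mul_assoc 2 π, norm_sq_exp_I_mul_sub_one]
  have hsub : θ - ((-k : ℤ) : ℝ) = θ + k := by push_cast; ring
  simp only [hsub, norm_mul, Complex.norm_I, Complex.norm_real, Complex.norm_intCast,
    norm_eq_abs, mul_one, mul_pow, sq_abs, Complex.norm_ofNat]
  have := pi_ne_zero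
  field_simp
  norm_num

theorem In1_value (n : ℕ) (hn : 1 ≤ n) :
    ∫ t : ℝ, Real.sin (t - π * n / 2) ^ 2 / (t ^ 2 - π ^ 2 * n ^ 2 / 4) ^ 2 =
      2 / (π * n ^ 2) := by
  have hn' : (n : ℤ) ≠ 0 := by omega
  have hunfold : ∫ x : ℝ, sin (π * x) ^ 2 / (x * (x + n)) ^ 2 = 2 * π ^ 2 / n ^ 2 := by
    refine integral_eq_of_ae_hasSum_add_intCast (by fun_prop) (fun x => by positivity)
      (by positivity) ?_
    filter_upwards [(Set.countable_range ((↑) : ℤ → ℝ)).ae_notMem volume] with x hx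
    exact_mod_cast hasSum_sin_sq_div_sq hx hn'
  have hshift := integral_add_right_eq_self (μ := volume)
    (fun t : ℝ => sin (t - π * n / 2) ^ 2 / (t ^ 2 - π ^ 2 * n ^ 2 / 4) ^ 2) (π * n / 2)
  have hscale := Measure.integral_comp_mul_left
    (fun s : ℝ => sin (s + π * n / 2 - π * n / 2) ^ 2 /
      ((s + π * n / 2) ^ 2 - π ^ 2 * n ^ 2 / 4) ^ 2) π
  have hintegrand (x : ℝ) : sin (π * x + π * n / 2 - π * n / 2) ^ 2 /
      ((π * x + π * n / 2) ^ 2 - π ^ 2 * n ^ 2 / 4) ^ 2 =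
      (π ^ 4)⁻¹ * (sin (π * x) ^ 2 / (x * (x + n)) ^ 2) := by
    rw [add_sub_cancel_right, show ((π * x + π * n / 2) ^ 2 - π ^ 2 * n ^ 2 / 4) ^ 2 =
      π ^ 4 * (x * (x + n)) ^ 2 by ring, div_mul_eq_div_div_swap, div_eq_inv_mul _ (π ^ 4)]
  simp_rw [hintegrand] at hscale
  rw [integral_const_mul, hunfold, hshift, abs_of_pos (inv_pos.2 pi_pos), smul_eq_mul] at hscale
  have hπ := pi_ne_zero
  rw [eq_inv_mul_iff_mul_eq₀ hπ] at hscale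
  rw [← hscale]
  field_simp
end

section
/- For every positive integer n, the integral ∫_{-∞}^{∞} [sin²(t - πn/2) / (t² - π²n²/4)²]² dt equals (4/(3π³n⁴)) · (1 + 15/(2π²n²)). -/
open Real MeasureTheory
open Filter Topology

theorem sinc_mul_self (x : ℝ) : sinc x * x = Real.sin x := by
  rcases eq_or_ne x 0 with rfl | hx
  · simp
  · rw [sinc_of_ne_zero hx]; field_simp

theorem sinc_sq_mul_one_add_sq_le (x : ℝ) : sinc x ^ 2 * (1 + x ^ 2) ≤ 2 := by
  have h₁ : sinc x ^ 2 ≤ 1 := (sq_le_one_iff_abs_le_one _).2 (abs_sinc_le_one x)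
  have h₂ : (sinc x * x) ^ 2 ≤ 1 := by rw [sinc_mul_self]; exact sin_sq_le_one x
  nlinarith

theorem integrable_sinc_sq : Integrable fun x : ℝ ↦ sinc x ^ 2 := by
  refine (integrable_inv_one_add_sq.const_mul 2).mono'
    (continuous_sinc.pow 2).aestronglyMeasurable (ae_of_all _ fun x ↦ ?_)
  rw [norm_of_nonneg (sq_nonneg _), ← div_eq_mul_inv, le_div_iff₀ (by positivity)]
  exact sinc_sq_mul_one_add_sq_le x

theorem integrable_mul_sinc_sq {g : ℝ → ℝ} (hg : Continuous g) (hb : ∀ x, |g x| ≤ 1) :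
    Integrable fun x ↦ g x * sinc x ^ 2 :=
  integrable_sinc_sq.bdd_mul (c := 1) hg.aestronglyMeasurable (ae_of_all _ hb)

theorem integrable_sin_sq_mul_sinc_sq :
    Integrable fun x : ℝ ↦ Real.sin x ^ 2 * sinc x ^ 2 :=
  integrable_mul_sinc_sq (by fun_prop) fun x ↦ by
    rw [abs_of_nonneg (sq_nonneg _)]; exact sin_sq_le_one x

theorem integrable_sin_mul_sinc_cube :
    Integrable fun x : ℝ ↦ Real.sin x * sinc x ^ 3 := by
  refine (integrable_mul_sinc_sq (g := fun x ↦ Real.sin x * sinc x)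
    (Real.continuous_sin.mul continuous_sinc) fun x ↦ ?_).congr (ae_of_all _ fun x ↦ by ring)
  rw [abs_mul]
  exact mul_le_one₀ (abs_sin_le_one x) (abs_nonneg _) (abs_sinc_le_one x)

theorem integrable_sinc_pow_four : Integrable fun x : ℝ ↦ sinc x ^ 4 := by
  refine (integrable_mul_sinc_sq (g := fun x ↦ sinc x ^ 2)
    (continuous_sinc.pow 2) fun x ↦ ?_).congr (ae_of_all _ fun x ↦ by ring)
  rw [abs_pow]
  exact pow_le_one₀ (abs_nonneg _) (abs_sinc_le_one x)

theorem integral_one_sub_mul_cexp {c : ℂ} (hc : c ≠ 0) :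
    ∫ x in (0 : ℝ)..1, ((1 - x : ℝ) : ℂ) * Complex.exp (c * x) =
      (Complex.exp c - 1 - c) / c ^ 2 := by
  have hd (x : ℝ) : HasDerivAt (fun x : ℝ ↦ ((1 - (x : ℂ)) / c + 1 / c ^ 2) * Complex.exp (c * x))
      (((1 - x : ℝ) : ℂ) * Complex.exp (c * x)) x := by
    have h₀ : HasDerivAt (fun x : ℝ ↦ (x : ℂ)) 1 x := Complex.ofRealCLM.hasDerivAt
    refine ((((h₀.const_sub 1).div_const c).add_const (1 / c ^ 2)).mul
      (h₀.const_mul c).cexp).congr_deriv ?_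
    push_cast
    field_simp
    ring
  rw [intervalIntegral.integral_eq_sub_of_hasDerivAt (fun x _ ↦ hd x)
    (Continuous.intervalIntegrable (by fun_prop) _ _)]
  simp only [Complex.ofReal_one, Complex.ofReal_zero, mul_one, mul_zero, Complex.exp_zero]
  field_simp
  ring

/-- The Fourier transform of the triangle function is `sinc (π w) ^ 2`. -/
theorem fourier_triangle {w : ℝ} (hw : w ≠ 0) :
    FourierTransform.fourier (fun x : ℝ ↦ ((max 0 (1 - |x|) : ℝ) : ℂ)) w =
      ((sinc (π * w) ^ 2 : ℝ) : ℂ) := by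
  rw [fourier_real_eq_integral_exp_smul]
  set c : ℂ := ↑(-2 * π * w) * Complex.I with hcdef
  have hc : c ≠ 0 := by simp [hcdef, hw, pi_ne_zero]
  have key : ∀ v : ℝ, Complex.exp (↑(-2 * π * v * w) * Complex.I) •
      ((max 0 (1 - |v|) : ℝ) : ℂ) = ((max 0 (1 - |v|) : ℝ) : ℂ) * Complex.exp (c * v) := by
    intro v
    rw [smul_eq_mul, mul_comm, hcdef]
    push_cast
    ring_nf
  simp_rw [key]
  have hcont : Continuous fun v : ℝ ↦ ((max 0 (1 - |v|) : ℝ) : ℂ) * Complex.exp (c * v) := by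
    fun_prop
  have hsupp : Function.support (fun v : ℝ ↦ ((max 0 (1 - |v|) : ℝ) : ℂ) * Complex.exp (c * v)) ⊆
      Set.Ioc (-1) 1 := by
    intro v hv
    by_contra h
    apply hv
    have : 1 ≤ |v| := by
      by_contra! h'
      exact h ⟨(abs_lt.1 h').1, (abs_lt.1 h').2.le⟩
    simp [max_eq_left (sub_nonpos.2 this)]
  rw [← intervalIntegral.integral_eq_integral_of_support_subset hsupp,
    ← intervalIntegral.integral_add_adjacent_intervals (b := 0) (hcont.intervalIntegrable _ _)
      (hcont.intervalIntegrable _ _)]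
  have hpos : ∫ v in (0 : ℝ)..1, ((max 0 (1 - |v|) : ℝ) : ℂ) * Complex.exp (c * v) =
      (Complex.exp c - 1 - c) / c ^ 2 := by
    rw [← integral_one_sub_mul_cexp hc]
    refine intervalIntegral.integral_congr fun v hv ↦ ?_
    rw [Set.uIcc_of_le zero_le_one] at hv
    simp only [abs_of_nonneg hv.1, max_eq_right (sub_nonneg.2 hv.2)]
  have hneg : ∫ v in (-1 : ℝ)..0, ((max 0 (1 - |v|) : ℝ) : ℂ) * Complex.exp (c * v) =
      (Complex.exp (-c) - 1 - -c) / (-c) ^ 2 := by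
    rw [← integral_one_sub_mul_cexp (neg_ne_zero.2 hc), ← neg_zero,
      ← intervalIntegral.integral_comp_neg, neg_zero]
    refine intervalIntegral.integral_congr fun v hv ↦ ?_
    rw [Set.uIcc_of_le zero_le_one] at hv
    simp only [abs_neg, abs_of_nonneg hv.1, max_eq_right (sub_nonneg.2 hv.2)]
    push_cast
    ring_nf
  rw [hpos, hneg]
  have hexp : Complex.exp c + Complex.exp (-c) = 2 - 4 * (Real.sin (π * w) : ℂ) ^ 2 := by
    have h := Complex.two_cos (2 * (π * w))
    rw [Complex.cos_two_mul, Complex.cos_sq'] at h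
    rw [hcdef]
    push_cast
    have e : (-2 * π * w * Complex.I : ℂ) = -(2 * (π * w)) * Complex.I := by ring
    rw [e, neg_mul, neg_neg, ← neg_mul, add_comm, ← h]
    ring
  have hc2 : c ^ 2 = -(4 * (π * w) ^ 2) := by
    rw [hcdef, mul_pow, Complex.I_sq]
    push_cast
    ring
  have hw' : (w : ℂ) ≠ 0 := by exact_mod_cast hw
  have hπ : (π : ℂ) ≠ 0 := by exact_mod_cast pi_ne_zero
  rw [sinc_of_ne_zero (mul_ne_zero pi_ne_zero hw), neg_sq, ← add_div,
    show Complex.exp (-c) - 1 - -c + (Complex.exp c - 1 - c) =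
      Complex.exp c + Complex.exp (-c) - 2 by ring, hexp, hc2]
  push_cast
  field_simp
  ring

theorem integral_sinc_sq : ∫ x : ℝ, sinc x ^ 2 = π := by
  set f : ℝ → ℂ := fun x ↦ ((max 0 (1 - |x|) : ℝ) : ℂ) with hf
  have hcont : Continuous f := by fun_prop
  have hcomp : HasCompactSupport f := by
    refine HasCompactSupport.intro (K := Set.Icc (-1) 1) isCompact_Icc fun x hx ↦ ?_
    have : 1 ≤ |x| := by
      by_contra! h
      exact hx ⟨(abs_lt.1 h).1.le, (abs_lt.1 h).2.le⟩
    simp [hf, max_eq_left (sub_nonpos.2 this)]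
  have hae : (fun w : ℝ ↦ ((sinc (π * w) ^ 2 : ℝ) : ℂ)) =ᵐ[volume] FourierTransform.fourier f := by
    filter_upwards [compl_mem_ae_iff.2 (measure_singleton (0 : ℝ))] with w hw
    exact (fourier_triangle hw).symm
  have hint : Integrable (FourierTransform.fourier f) :=
    ((integrable_sinc_sq.comp_mul_left' pi_ne_zero).ofReal).congr hae
  have h := congrFun (hcont.fourierInv_fourier_eq (hcont.integrable_of_hasCompactSupport hcomp)
    hint) 0
  rw [fourierInv_eq'] at h
  simp only [inner_zero_right, mul_zero, Complex.ofReal_zero, zero_mul, Complex.exp_zero,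
    one_smul] at h
  rw [← integral_congr_ae hae, integral_complex_ofReal,
    Measure.integral_comp_mul_left (fun x ↦ sinc x ^ 2) π] at h
  have h' : |π⁻¹| * ∫ x : ℝ, sinc x ^ 2 = 1 := by
    rw [hf] at h
    simpa using (Complex.ofReal_injective (h.trans (by simp)) :
      |π⁻¹| • ∫ x : ℝ, sinc x ^ 2 = 1)
  rw [abs_of_pos (inv_pos.2 pi_pos), inv_mul_eq_one₀ pi_ne_zero] at h'
  exact h'.symm

theorem integrable_sinc_two_mul_sq : Integrable fun x : ℝ ↦ sinc (2 * x) ^ 2 :=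
  integrable_sinc_sq.comp_mul_left' two_ne_zero

theorem integral_sinc_two_mul_sq : ∫ x : ℝ, sinc (2 * x) ^ 2 = π / 2 := by
  rw [Measure.integral_comp_mul_left (fun x ↦ sinc x ^ 2) 2, integral_sinc_sq, smul_eq_mul,
    abs_of_pos (by norm_num)]
  ring

theorem sinc_two_mul (x : ℝ) : sinc (2 * x) = sinc x * Real.cos x := by
  rcases eq_or_ne x 0 with rfl | hx
  · simp
  · rw [sinc_of_ne_zero hx, sinc_of_ne_zero (mul_ne_zero two_ne_zero hx), Real.sin_two_mul]
    field_simp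

theorem integral_sin_sq_mul_sinc_sq :
    ∫ x : ℝ, Real.sin x ^ 2 * sinc x ^ 2 = π / 2 := by
  calc ∫ x : ℝ, Real.sin x ^ 2 * sinc x ^ 2
      = ∫ x : ℝ, (sinc x ^ 2 - sinc (2 * x) ^ 2) := by
        refine integral_congr_ae (ae_of_all _ fun x ↦ ?_)
        simp only [sinc_two_mul, mul_pow, Real.cos_sq']
        ring
    _ = π / 2 := by
        rw [integral_sub integrable_sinc_sq integrable_sinc_two_mul_sq, integral_sinc_sq,
          integral_sinc_two_mul_sq]
        ring

theorem tendsto_sinc_cocompact : Tendsto sinc (cocompact ℝ) (𝓝 0) := by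
  refine squeeze_zero_norm' (a := fun x : ℝ ↦ ‖x‖⁻¹) ?_
    (tendsto_inv_atTop_zero.comp (tendsto_norm_cocompact_atTop (E := ℝ)))
  filter_upwards [(isCompact_singleton (x := (0 : ℝ))).compl_mem_cocompact] with x hx
  rw [sinc_of_ne_zero hx, norm_div, div_eq_mul_inv]
  exact mul_le_of_le_one_left (by positivity) (abs_sin_le_one x)

theorem integral_sinc_pow_four : ∫ x : ℝ, sinc x ^ 4 = 2 * π / 3 := by
  set e : ℝ → ℝ := fun x ↦
    sinc x ^ 4 - 2 * sinc (2 * x) ^ 2 + 2 / 3 * (Real.sin x ^ 2 * sinc x ^ 2) with he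
  have hint : Integrable e := (integrable_sinc_pow_four.sub'
    (integrable_sinc_two_mul_sq.const_mul 2)).fun_add
    (integrable_sin_sq_mul_sinc_sq.const_mul (2 / 3))
  set F : ℝ → ℝ := fun x ↦
    (-(1 / 3) * (Real.sin x * sinc x) - 2 / 3 * (Real.sin x * Real.cos x)) * sinc x ^ 2 with hF
  have hFcont : Continuous F := by
    have := continuous_sinc
    fun_prop
  have hderiv (x : ℝ) (hx : x ∈ Set.Ioi 0) : HasDerivAt F (e x) x := by
    have hx0 : x ≠ 0 := (Set.mem_Ioi.1 hx).ne'
    have hd : HasDerivAt sinc ((Real.cos x * x - Real.sin x * 1) / x ^ 2) x := by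
      refine ((Real.hasDerivAt_sin x).div (hasDerivAt_id' x) hx0).congr_of_eventuallyEq ?_
      filter_upwards [isOpen_ne.mem_nhds hx0] with y hy
      exact sinc_of_ne_zero hy
    have hs := Real.hasDerivAt_sin x
    refine ((((hs.mul hd).const_mul (-(1 / 3))).sub
      ((hs.mul (Real.hasDerivAt_cos x)).const_mul (2 / 3))).mul (hd.pow 2)).congr_deriv ?_
    simp only [he, sinc_two_mul, sinc_of_ne_zero hx0, Pi.mul_apply, Pi.pow_apply, Pi.sub_apply]
    push_cast
    rw [pow_one]
    field_simp
    ring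
  have hlim : Tendsto F atTop (𝓝 0) := by
    have h := (tendsto_sinc_cocompact.mono_left atTop_le_cocompact).pow 2
    rw [zero_pow two_ne_zero] at h
    refine h.zero_mul_isBoundedUnder_le ?_ |>.congr fun x ↦ mul_comm _ _
    refine isBoundedUnder_of ⟨1, fun x ↦ ?_⟩
    have h₁ : |Real.sin x * sinc x| ≤ 1 := by
      rw [abs_mul]
      exact mul_le_one₀ (abs_sin_le_one x) (abs_nonneg _) (abs_sinc_le_one x)
    have h₂ : |Real.sin x * Real.cos x| ≤ 1 := by
      rw [abs_mul]
      exact mul_le_one₀ (abs_sin_le_one x) (abs_nonneg _) (abs_cos_le_one x)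
    rw [abs_le] at h₁ h₂
    simp only [Function.comp, Real.norm_eq_abs, abs_le]
    constructor <;> linarith
  have hhalf := integral_Ioi_of_hasDerivAt_of_tendsto hFcont.continuousWithinAt hderiv
    hint.integrableOn hlim
  have hzero : ∫ x, e x = 0 := by
    have habs : ∀ x, e |x| = e x := fun x ↦ by
      rcases abs_choice x with h | h <;> simp [he, h, sinc_neg]
    rw [← integral_congr_ae (ae_of_all _ habs), integral_comp_abs, hhalf]
    simp [hF]
  rw [he, integral_add (integrable_sinc_pow_four.sub' (integrable_sinc_two_mul_sq.const_mul 2))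
    (integrable_sin_sq_mul_sinc_sq.const_mul (2 / 3)), integral_sub integrable_sinc_pow_four
    (integrable_sinc_two_mul_sq.const_mul 2), integral_const_mul, integral_const_mul,
    integral_sin_sq_mul_sinc_sq, integral_sinc_two_mul_sq] at hzero
  linarith

/-- If a bounded continuous function vanishes at infinity, the difference with any of its
translates integrates to zero as soon as it is integrable. -/
theorem integral_comp_add_right_sub_eq_zero {F : ℝ → ℝ} {C c : ℝ} (hF : Continuous F)
    (hC : ∀ x, |F x| ≤ C) (hlim : Tendsto F (cocompact ℝ) (𝓝 0))
    (hint : Integrable fun x ↦ F (x + c) - F x) : ∫ x, (F (x + c) - F x) = 0 := by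
  have hd (x : ℝ) : HasDerivAt (fun x ↦ ∫ s in (0 : ℝ)..c, F (x + s)) (F (x + c) - F x) x := by
    have h : HasDerivAt (fun x ↦ (∫ s in (0 : ℝ)..(x + c), F s) - ∫ s in (0 : ℝ)..x, F s)
        (F (x + c) - F x) x :=
      ((hF.integral_hasStrictDerivAt 0 (x + c)).hasDerivAt.comp_add_const x c).sub
        (hF.integral_hasStrictDerivAt 0 x).hasDerivAt
    convert h using 2 with y
    rw [intervalIntegral.integral_comp_add_left, add_zero,
      intervalIntegral.integral_interval_sub_left (hF.intervalIntegrable _ _)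
        (hF.intervalIntegrable _ _)]
  have ht (l : Filter ℝ) [l.IsCountablyGenerated] (hl : ∀ s, Tendsto (· + s) l (cocompact ℝ)) :
      Tendsto (fun x ↦ ∫ s in (0 : ℝ)..c, F (x + s)) l (𝓝 0) := by
    have := intervalIntegral.tendsto_integral_filter_of_dominated_convergence
      (μ := volume) (a := 0) (b := c) (l := l)
      (F := fun x s ↦ F (x + s)) (f := fun _ ↦ 0) (fun _ ↦ C)
      (Eventually.of_forall fun x ↦
        (by fun_prop : Continuous fun s ↦ F (x + s)).aestronglyMeasurable)
      (Eventually.of_forall fun x ↦ ae_of_all _ fun s _ ↦ hC _)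
      intervalIntegrable_const (ae_of_all _ fun s _ ↦ hlim.comp (hl s))
    simpa using this
  rw [integral_of_hasDerivAt_of_tendsto hd hint
    (ht atBot fun s ↦ (tendsto_atBot_add_const_right _ s tendsto_id).mono_right atBot_le_cocompact)
    (ht atTop fun s ↦ (tendsto_atTop_add_const_right _ s tendsto_id).mono_right
      atTop_le_cocompact), sub_zero]

theorem sin_add_nat_mul_pi_sq (x : ℝ) (n : ℕ) :
    Real.sin (x + n * π) ^ 2 = Real.sin x ^ 2 := by
  rw [Real.sin_add_nat_mul_pi, mul_pow, ← pow_mul, mul_comm n, pow_mul]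
  simp

theorem integrable_sin_cube_mul_sinc_shift_sub (n : ℕ) :
    Integrable fun x : ℝ ↦ Real.sin (x + n * π) ^ 3 * sinc (x + n * π) -
      Real.sin x ^ 3 * sinc x := by
  set b : ℝ := n * π
  have hmeas : Continuous fun x : ℝ ↦ Real.sin (x + b) ^ 3 * sinc (x + b) -
      Real.sin x ^ 3 * sinc x := by
    have := continuous_sinc
    fun_prop
  refine (((integrable_sinc_sq.add (integrable_sinc_sq.comp_add_right b))).const_mul |b|).mono'
    hmeas.aestronglyMeasurable ?_
  filter_upwards [compl_mem_ae_iff.2 (measure_singleton (0 : ℝ)),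
    compl_mem_ae_iff.2 (measure_singleton (-b))] with x hx hxb
  have hx0 : x ≠ 0 := hx
  have hxb0 : x + b ≠ 0 := fun h ↦ hxb (by simp; linarith)
  have hs : Real.sin (x + b) ^ 2 = Real.sin x ^ 2 := sin_add_nat_mul_pi_sq x n
  have hs4 : Real.sin (x + b) ^ 4 = Real.sin x ^ 2 * Real.sin (x + b) ^ 2 := by
    rw [← hs]; ring
  have hs4' : Real.sin x ^ 4 = Real.sin x ^ 2 * Real.sin (x + b) ^ 2 := by
    rw [hs]; ring
  have heq : Real.sin (x + b) ^ 3 * sinc (x + b) - Real.sin x ^ 3 * sinc x =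
      -b * (Real.sin x * Real.sin (x + b)) * (sinc x * sinc (x + b)) := by
    rw [sinc_of_ne_zero hx0, sinc_of_ne_zero hxb0]
    have e₁ : Real.sin (x + b) ^ 3 * (Real.sin (x + b) / (x + b)) =
      Real.sin (x + b) ^ 4 / (x + b) := by ring
    have e₂ : Real.sin x ^ 3 * (Real.sin x / x) = Real.sin x ^ 4 / x := by ring
    rw [e₁, e₂, hs4, hs4']
    field_simp
    ring
  rw [heq, norm_mul, norm_mul, norm_neg, Real.norm_eq_abs b, mul_assoc]
  refine mul_le_mul_of_nonneg_left ?_ (abs_nonneg b)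
  have h₁ : ‖Real.sin x * Real.sin (x + b)‖ ≤ 1 := by
    rw [norm_mul]
    exact mul_le_one₀ (abs_sin_le_one x) (norm_nonneg _) (abs_sin_le_one _)
  refine (mul_le_of_le_one_left (norm_nonneg _) h₁).trans ?_
  rw [Real.norm_eq_abs, abs_le, Pi.add_apply]
  constructor <;> nlinarith [sq_nonneg (sinc x + sinc (x + b)), sq_nonneg (sinc x - sinc (x + b))]

theorem integral_sin_cube_mul_sinc_shift_sub (n : ℕ) :
    ∫ x : ℝ, (Real.sin (x + n * π) ^ 3 * sinc (x + n * π) - Real.sin x ^ 3 * sinc x) = 0 := by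
  have hb (x : ℝ) : |Real.sin x ^ 3| ≤ 1 := by
    rw [abs_pow]; exact pow_le_one₀ (abs_nonneg _) (abs_sin_le_one x)
  refine integral_comp_add_right_sub_eq_zero (F := fun x ↦ Real.sin x ^ 3 * sinc x) (C := 1)
    ((Real.continuous_sin.pow 3).mul continuous_sinc) (fun x ↦ ?_) ?_
    (integrable_sin_cube_mul_sinc_shift_sub n)
  · rw [abs_mul]
    exact mul_le_one₀ (hb x) (abs_nonneg _) (abs_sinc_le_one x)
  · exact (tendsto_sinc_cocompact.zero_mul_isBoundedUnder_le
      (isBoundedUnder_of ⟨1, hb⟩)).congr fun x ↦ mul_comm _ _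

theorem partial_fractions_pow_four {u v b : ℝ} (hu : u ≠ 0) (hv : v ≠ 0) (hb : b ≠ 0)
    (h : v = u + b) : 1 / (u * v) ^ 4 =
      (1 / b ^ 4) * (1 / u ^ 4 + 1 / v ^ 4) + (10 / b ^ 6) * (1 / u ^ 2 + 1 / v ^ 2) +
      (4 / b ^ 5) * (1 / v ^ 3 - 1 / u ^ 3) + (20 / b ^ 7) * (1 / v - 1 / u) := by
  obtain rfl : b = v - u := by linarith
  field_simp
  ring

theorem In2_value (n : ℕ) (hn : 1 ≤ n) :
    ∫ t : ℝ, (Real.sin (t - π * n / 2) ^ 2 / (t ^ 2 - π ^ 2 * n ^ 2 / 4) ^ 2) ^ 2 =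
      4 / (3 * π ^ 3 * n ^ 4) * (1 + 15 / (2 * π ^ 2 * n ^ 2)) := by
  have hn0 : (n : ℝ) ≠ 0 := by exact_mod_cast (Nat.one_le_iff_ne_zero.1 hn)
  have hπ := pi_ne_zero
  set b : ℝ := n * π with hbdef
  have hb : b ≠ 0 := mul_ne_zero hn0 hπ
  rw [← integral_add_right_eq_self _ (π * n / 2)]
  have hae : ∀ᵐ u : ℝ, (Real.sin (u + π * n / 2 - π * n / 2) ^ 2 /
      ((u + π * n / 2) ^ 2 - π ^ 2 * n ^ 2 / 4) ^ 2) ^ 2 =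
      (1 / b ^ 4) * (sinc u ^ 4 + sinc (u + b) ^ 4) +
      (10 / b ^ 6) * (Real.sin u ^ 2 * sinc u ^ 2 + Real.sin (u + b) ^ 2 * sinc (u + b) ^ 2) +
      (4 / b ^ 5) * (Real.sin (u + b) * sinc (u + b) ^ 3 - Real.sin u * sinc u ^ 3) +
      (20 / b ^ 7) * (Real.sin (u + b) ^ 3 * sinc (u + b) - Real.sin u ^ 3 * sinc u) := by
    filter_upwards [compl_mem_ae_iff.2 (measure_singleton (0 : ℝ)),
      compl_mem_ae_iff.2 (measure_singleton (-b))] with u hu hub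
    have hu0 : u ≠ 0 := hu
    have hub0 : u + b ≠ 0 := fun h ↦ hub (by simp; linarith)
    have hs : Real.sin (u + b) ^ 4 = Real.sin u ^ 4 := by
      have := sin_add_nat_mul_pi_sq u n
      calc Real.sin (u + b) ^ 4 = (Real.sin (u + b) ^ 2) ^ 2 := by ring
        _ = (Real.sin u ^ 2) ^ 2 := by rw [hbdef, this]
        _ = _ := by ring
    have hden : (u + π * n / 2) ^ 2 - π ^ 2 * n ^ 2 / 4 = u * (u + b) := by
      rw [hbdef]; ring
    rw [hden, add_sub_cancel_right, sinc_of_ne_zero hu0, sinc_of_ne_zero hub0]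
    calc (Real.sin u ^ 2 / (u * (u + b)) ^ 2) ^ 2
        = Real.sin u ^ 4 * (1 / (u * (u + b)) ^ 4) := by
          rw [div_pow, ← pow_mul, ← pow_mul, mul_one_div]
      _ = (1 / b ^ 4) * (Real.sin u ^ 4 / u ^ 4 + Real.sin u ^ 4 / (u + b) ^ 4) +
          (10 / b ^ 6) * (Real.sin u ^ 4 / u ^ 2 + Real.sin u ^ 4 / (u + b) ^ 2) +
          (4 / b ^ 5) * (Real.sin u ^ 4 / (u + b) ^ 3 - Real.sin u ^ 4 / u ^ 3) +
          (20 / b ^ 7) * (Real.sin u ^ 4 / (u + b) - Real.sin u ^ 4 / u) := by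
        rw [partial_fractions_pow_four hu0 hub0 hb rfl]; simp only [div_eq_mul_inv]; ring
      _ = (1 / b ^ 4) * (Real.sin u ^ 4 / u ^ 4 + Real.sin (u + b) ^ 4 / (u + b) ^ 4) +
          (10 / b ^ 6) * (Real.sin u ^ 4 / u ^ 2 + Real.sin (u + b) ^ 4 / (u + b) ^ 2) +
          (4 / b ^ 5) * (Real.sin (u + b) ^ 4 / (u + b) ^ 3 - Real.sin u ^ 4 / u ^ 3) +
          (20 / b ^ 7) * (Real.sin (u + b) ^ 4 / (u + b) - Real.sin u ^ 4 / u) := by rw [hs]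
      _ = _ := by
        generalize u + b = v
        ring
  rw [integral_congr_ae hae]
  have i₄ := integrable_sinc_pow_four
  have i₃ := integrable_sin_mul_sinc_cube
  have i₂ := integrable_sin_sq_mul_sinc_sq
  have i₄' := i₄.comp_add_right b
  have i₃' := i₃.comp_add_right b
  have i₂' := i₂.comp_add_right b
  have i₁ := integrable_sin_cube_mul_sinc_shift_sub n
  have h₁ := integral_sin_cube_mul_sinc_shift_sub n
  rw [← hbdef] at i₁ h₁
  have j₄ := (i₄.fun_add i₄').const_mul (1 / b ^ 4)
  have j₂ := (i₂.fun_add i₂').const_mul (10 / b ^ 6)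
  have j₃ := (i₃'.sub' i₃).const_mul (4 / b ^ 5)
  have j₁ := i₁.const_mul (20 / b ^ 7)
  rw [integral_add ((j₄.fun_add j₂).fun_add j₃) j₁, integral_add (j₄.fun_add j₂) j₃,
    integral_add j₄ j₂, integral_const_mul, integral_const_mul, integral_const_mul, integral_const_mul,
    integral_add i₄ i₄', integral_add i₂ i₂', integral_sub i₃' i₃, h₁,
    integral_add_right_eq_self (fun x ↦ sinc x ^ 4) b,
    integral_add_right_eq_self (fun x ↦ Real.sin x ^ 2 * sinc x ^ 2) b,
    integral_add_right_eq_self (fun x ↦ Real.sin x * sinc x ^ 3) b,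
    integral_sinc_pow_four, integral_sin_sq_mul_sinc_sq, hbdef]
  field_simp
  ring
end

section
/- For every positive integer k, the Fourier transform of u ↦ (sin u / u)^{2k}, evaluated at 0 (i.e., the 2k-fold self-convolution structure), yields ∫_{-∞}^{∞} (sin u/u)^{2k} du = π · Σ_{i=0}^{2k} (-1)^i C(2k,i) |k - i|_+^{2k-1} / (2k-1)!, where |x|_+ = max(x, 0); this sum equals (π/(2k-1)!) Σ_{i=0}^{k-1} (-1)^i C(2k,i)(k-i)^{2k-1} by symmetry. -/
open Real MeasureTheory Finset

/-- The remainders of the Taylor expansions of cosine and sine at `0`, normalised in sign so that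
each one is the primitive of the preceding one. -/
noncomputable def cosRemainder : ℕ → ℝ → ℝ
  | 0 => cos
  | 1 => sin
  | n + 2 => fun x ↦ x ^ n / n.factorial - cosRemainder n x

theorem hasDerivAt_cosRemainder (n : ℕ) (x : ℝ) :
    HasDerivAt (cosRemainder (n + 1)) (cosRemainder n x) x := by
  induction n using Nat.twoStepInduction with
  | zero => exact hasDerivAt_sin x
  | one => simpa [cosRemainder] using (hasDerivAt_cos x).const_sub 1
  | more n ih _ =>
    refine HasDerivAt.sub ?_ ih
    convert! (hasDerivAt_pow (n + 1) x).div_const ((n + 1).factorial : ℝ) using 1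
    rw [Nat.factorial_succ]
    push_cast
    field_simp

theorem continuous_cosRemainder (n : ℕ) : Continuous (cosRemainder n) := by
  cases n with
  | zero => exact continuous_cos
  | succ n => exact continuous_iff_continuousAt.2 fun x ↦ (hasDerivAt_cosRemainder n x).continuousAt

theorem cosRemainder_succ_zero (n : ℕ) : cosRemainder (n + 1) 0 = 0 := by
  induction n using Nat.twoStepInduction with
  | zero => exact sin_zero
  | one => simp [cosRemainder]
  | more n ih _ => simp [cosRemainder, ih]

theorem cosRemainder_nonneg (n : ℕ) {x : ℝ} (hx : 0 ≤ x) : 0 ≤ cosRemainder (n + 2) x := by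
  induction n generalizing x with
  | zero => simpa [cosRemainder] using cos_le_one x
  | succ n ih =>
    rw [← cosRemainder_succ_zero (n + 2)]
    refine monotoneOn_of_deriv_nonneg (convex_Ici 0) (continuous_cosRemainder _).continuousOn
      (fun y _ ↦ (hasDerivAt_cosRemainder _ y).differentiableAt.differentiableWithinAt)
      (fun y hy ↦ ?_) Set.self_mem_Ici hx hx
    rw [(hasDerivAt_cosRemainder _ y).deriv]
    exact ih (interior_subset hy)

theorem cosRemainder_two_mul (m : ℕ) (x : ℝ) :
    cosRemainder (2 * m) x =
      (-1) ^ m * (cos x - ∑ j ∈ range m, (-1) ^ j * x ^ (2 * j) / (2 * j).factorial) := by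
  induction m with
  | zero => simp [cosRemainder]
  | succ m ih =>
    rw [show 2 * (m + 1) = 2 * m + 2 by ring, sum_range_succ]
    change x ^ (2 * m) / (2 * m).factorial - cosRemainder (2 * m) x = _
    rw [ih]
    have : ((-1 : ℝ) ^ m) * (-1) ^ m = 1 := by rw [← mul_pow]; simp
    linear_combination (-x ^ (2 * m) / (2 * m).factorial) * this

theorem cosRemainder_abs (m : ℕ) (x : ℝ) : cosRemainder (2 * m) |x| = cosRemainder (2 * m) x := by
  simp only [cosRemainder_two_mul, cos_abs, pow_mul, sq_abs]

theorem integrableOn_pow_mul_exp_neg_mul (n : ℕ) {t : ℝ} (ht : 0 < t) :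
    IntegrableOn (fun x ↦ x ^ n * exp (-(t * x))) (Set.Ioi 0) := by
  simpa [rpow_one, neg_mul] using
    integrableOn_rpow_mul_exp_neg_mul_rpow (p := 1) (s := n) (b := t)
      (by linarith [n.cast_nonneg (α := ℝ)]) one_pos ht

theorem integral_pow_mul_exp_neg_mul (n : ℕ) {t : ℝ} (ht : 0 < t) :
    ∫ x in Set.Ioi 0, x ^ n * exp (-(t * x)) = n.factorial / t ^ (n + 1) := by
  have := integral_rpow_mul_exp_neg_mul_Ioi (a := n + 1) (r := t) (by positivity) ht
  rw [Gamma_nat_eq_factorial, ← Nat.cast_succ, rpow_natCast] at this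
  simpa [div_eq_inv_mul] using this

theorem integrableOn_cos_mul_exp_neg_mul {t : ℝ} (ht : 0 < t) :
    IntegrableOn (fun x ↦ cos x * exp (-(t * x))) (Set.Ioi 0) := by
  have := integrableOn_pow_mul_exp_neg_mul 0 ht
  simp only [pow_zero, one_mul] at this
  refine this.mono' (by fun_prop) (.of_forall fun x ↦ ?_)
  rw [norm_mul, norm_of_nonneg (exp_nonneg _)]
  exact mul_le_of_le_one_left (exp_nonneg _) (abs_cos_le_one x)

theorem integral_cos_mul_exp_neg_mul {t : ℝ} (ht : 0 < t) :
    ∫ x in Set.Ioi 0, cos x * exp (-(t * x)) = t / (t ^ 2 + 1) := by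
  have hlim : Filter.Tendsto (fun x ↦ exp (-(t * x))) Filter.atTop (nhds 0) :=
    tendsto_exp_neg_atTop_nhds_zero.comp (Filter.tendsto_id.const_mul_atTop ht)
  have hderiv (x : ℝ) : HasDerivAt
      (fun x ↦ exp (-(t * x)) * ((sin x - t * cos x) / (t ^ 2 + 1))) (cos x * exp (-(t * x))) x := by
    convert! (((hasDerivAt_id x).const_mul t).neg.exp).mul
      (((hasDerivAt_sin x).sub ((hasDerivAt_cos x).const_mul t)).div_const (t ^ 2 + 1)) using 1
    simp
    field_simp
    ring
  rw [integral_Ioi_of_hasDerivAt_of_tendsto' (m := 0) (fun x _ ↦ hderiv x)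
    (integrableOn_cos_mul_exp_neg_mul ht)]
  · simp [neg_div]
  · refine hlim.zero_mul_isBoundedUnder_le
      (Filter.isBoundedUnder_of ⟨(1 + t * 1) / (t ^ 2 + 1), fun x ↦ ?_⟩)
    simp only [Function.comp_apply, Real.norm_eq_abs]
    rw [abs_div, abs_of_pos (show 0 < t ^ 2 + 1 by positivity)]
    gcongr
    refine (abs_sub _ _).trans (add_le_add (abs_sin_le_one x) ?_)
    rw [abs_mul, abs_of_pos ht]
    gcongr
    exact abs_cos_le_one x

theorem integrableOn_cosRemainder_mul_exp_neg_mul (m : ℕ) {t : ℝ} (ht : 0 < t) :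
    IntegrableOn (fun x ↦ cosRemainder (2 * m) x * exp (-(t * x))) (Set.Ioi 0) := by
  induction m with
  | zero => exact integrableOn_cos_mul_exp_neg_mul ht
  | succ m ih =>
    refine (((integrableOn_pow_mul_exp_neg_mul (2 * m) ht).div_const
      ((2 * m).factorial : ℝ)).sub ih).congr (.of_forall fun x ↦ ?_)
    simp only [Pi.sub_apply, show 2 * (m + 1) = 2 * m + 2 by ring, cosRemainder]
    ring

theorem integral_cosRemainder_mul_exp_neg_mul (m : ℕ) {t : ℝ} (ht : 0 < t) :
    ∫ x in Set.Ioi 0, cosRemainder (2 * m) x * exp (-(t * x)) =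
      t / (t ^ (2 * m) * (t ^ 2 + 1)) := by
  induction m with
  | zero => simpa [cosRemainder] using integral_cos_mul_exp_neg_mul ht
  | succ m ih =>
    have (x : ℝ) : cosRemainder (2 * (m + 1)) x * exp (-(t * x)) =
        x ^ (2 * m) * exp (-(t * x)) / (2 * m).factorial -
          cosRemainder (2 * m) x * exp (-(t * x)) := by
      simp only [show 2 * (m + 1) = 2 * m + 2 by ring, cosRemainder]
      ring
    simp only [this]
    rw [integral_sub ((integrableOn_pow_mul_exp_neg_mul (2 * m) ht).div_const _)
      (integrableOn_cosRemainder_mul_exp_neg_mul m ht), ih, integral_div,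
      integral_pow_mul_exp_neg_mul _ ht]
    have := Nat.factorial_ne_zero (2 * m)
    field_simp
    ring

theorem integrable_uncurry_cosRemainder_mul_pow_mul_exp {m : ℕ} (hm : 1 ≤ m) :
    Integrable (Function.uncurry fun x t : ℝ ↦
        cosRemainder (2 * m) x * (t ^ (2 * m - 1) * exp (-(x * t))))
      ((volume.restrict (Set.Ioi 0)).prod (volume.restrict (Set.Ioi 0))) := by
  obtain ⟨m, rfl⟩ := Nat.exists_eq_add_of_le' hm
  have := continuous_cosRemainder (2 * (m + 1))
  refine (integrable_prod_iff' (Continuous.aestronglyMeasurable (by fun_prop))).2 ⟨?_, ?_⟩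
  · filter_upwards [ae_restrict_mem measurableSet_Ioi] with t (ht : 0 < t)
    convert! (integrableOn_cosRemainder_mul_exp_neg_mul (m + 1) ht).const_mul
      (t ^ (2 * (m + 1) - 1)) using 2 with x
    simp only [Function.uncurry, mul_comm x t]
    ring
  · refine (integrable_inv_one_add_sq.restrict (s := Set.Ioi 0)).congr ?_
    filter_upwards [ae_restrict_mem measurableSet_Ioi] with t (ht : 0 < t)
    have (x : ℝ) (hx : x ∈ Set.Ioi 0) :
        ‖Function.uncurry (fun x t : ℝ ↦
          cosRemainder (2 * (m + 1)) x * (t ^ (2 * (m + 1) - 1) * exp (-(x * t)))) (x, t)‖ =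
        t ^ (2 * (m + 1) - 1) * (cosRemainder (2 * (m + 1)) x * exp (-(t * x))) := by
      have : 0 ≤ cosRemainder (2 * (m + 1)) x := cosRemainder_nonneg (2 * m) (le_of_lt hx)
      rw [Function.uncurry_apply_pair, norm_of_nonneg (mul_nonneg this (by positivity)),
        mul_comm x t]
      ring
    rw [setIntegral_congr_fun measurableSet_Ioi this, integral_const_mul,
      integral_cosRemainder_mul_exp_neg_mul _ ht, show 2 * (m + 1) - 1 = 2 * m + 1 by lia]
    field_simp
    ring

theorem integral_cosRemainder_mul_pow_mul_exp {m : ℕ} (hm : 1 ≤ m) {x : ℝ} (hx : x ∈ Set.Ioi 0) :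
    ∫ t in Set.Ioi 0, cosRemainder (2 * m) x * (t ^ (2 * m - 1) * exp (-(x * t))) =
      (2 * m - 1).factorial * (cosRemainder (2 * m) x / x ^ (2 * m)) := by
  rw [integral_const_mul, integral_pow_mul_exp_neg_mul _ hx, show 2 * m - 1 + 1 = 2 * m by lia]
  ring

theorem integrableOn_cosRemainder_div_pow {m : ℕ} (hm : 1 ≤ m) :
    IntegrableOn (fun x ↦ cosRemainder (2 * m) x / x ^ (2 * m)) (Set.Ioi 0) := by
  have h := (integrable_uncurry_cosRemainder_mul_pow_mul_exp hm).integral_prod_left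
  have h' := IntegrableOn.congr_fun h
    (fun x hx ↦ integral_cosRemainder_mul_pow_mul_exp hm hx) measurableSet_Ioi
  exact (integrable_const_mul_iff (Nat.cast_ne_zero.2 (Nat.factorial_ne_zero _)).isUnit _).1 h'

theorem integral_cosRemainder_div_pow {m : ℕ} (hm : 1 ≤ m) :
    ∫ x in Set.Ioi 0, cosRemainder (2 * m) x / x ^ (2 * m) =
      π / (2 * (2 * m - 1).factorial) := by
  have hswap := integral_integral_swap (integrable_uncurry_cosRemainder_mul_pow_mul_exp hm)
  rw [setIntegral_congr_fun measurableSet_Ioi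
      fun x hx ↦ integral_cosRemainder_mul_pow_mul_exp hm hx, integral_const_mul] at hswap
  have (t : ℝ) (ht : t ∈ Set.Ioi 0) :
      ∫ x in Set.Ioi 0, cosRemainder (2 * m) x * (t ^ (2 * m - 1) * exp (-(x * t))) =
        (1 + t ^ 2)⁻¹ := by
    have ht : 0 < t := ht
    obtain ⟨m, rfl⟩ := Nat.exists_eq_add_of_le' hm
    simp only [mul_comm _ t, mul_left_comm _ (t ^ _)]
    rw [integral_const_mul, integral_cosRemainder_mul_exp_neg_mul _ ht,
      show 2 * (m + 1) - 1 = 2 * m + 1 by lia]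
    field_simp
    ring
  rw [setIntegral_congr_fun measurableSet_Ioi this, integral_Ioi_inv_one_add_sq, arctan_zero,
    sub_zero] at hswap
  have := Nat.factorial_ne_zero (2 * m - 1)
  field_simp at hswap ⊢
  linarith

theorem cosRemainder_mul_div_pow {m : ℕ} {a : ℝ} (ha : a ≠ 0) {x : ℝ} :
    cosRemainder (2 * m) (a * x) / x ^ (2 * m) =
      |a| ^ (2 * m) * (cosRemainder (2 * m) (|a| * x) / (|a| * x) ^ (2 * m)) := by
  have := abs_pos.2 ha
  rw [← cosRemainder_abs, abs_mul, ← cosRemainder_abs m (|a| * x), abs_mul, abs_abs, mul_pow]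
  field_simp

theorem integrableOn_cosRemainder_mul_div_pow {m : ℕ} (hm : 1 ≤ m) (a : ℝ) :
    IntegrableOn (fun x ↦ cosRemainder (2 * m) (a * x) / x ^ (2 * m)) (Set.Ioi 0) := by
  rcases eq_or_ne a 0 with rfl | ha
  · have := cosRemainder_succ_zero (2 * m - 1)
    rw [show 2 * m - 1 + 1 = 2 * m by lia] at this
    simp [this]
  simp only [cosRemainder_mul_div_pow ha]
  refine Integrable.const_mul ?_ _
  refine (integrableOn_Ioi_comp_mul_left_iff
    (fun x ↦ cosRemainder (2 * m) x / x ^ (2 * m)) 0 (abs_pos.2 ha)).2 ?_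
  simpa using integrableOn_cosRemainder_div_pow hm

theorem integral_cosRemainder_mul_div_pow {m : ℕ} (hm : 1 ≤ m) (a : ℝ) :
    ∫ x in Set.Ioi 0, cosRemainder (2 * m) (a * x) / x ^ (2 * m) =
      |a| ^ (2 * m - 1) * (π / (2 * (2 * m - 1).factorial)) := by
  rcases eq_or_ne a 0 with rfl | ha
  · have := cosRemainder_succ_zero (2 * m - 1)
    rw [show 2 * m - 1 + 1 = 2 * m by lia] at this
    simp [this, show 2 * m - 1 ≠ 0 by lia]
  simp only [cosRemainder_mul_div_pow ha]
  have ha' := abs_pos.2 ha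
  rw [integral_const_mul, integral_comp_mul_left_Ioi
    (fun x ↦ cosRemainder (2 * m) x / x ^ (2 * m)) 0 ha', mul_zero,
    integral_cosRemainder_div_pow hm, smul_eq_mul, ← mul_assoc]
  congr 1
  nth_rewrite 1 [show 2 * m = 2 * m - 1 + 1 by lia]
  rw [pow_succ]
  field_simp

theorem sum_neg_one_pow_mul_choose_mul_sub_pow_eq_zero {n j : ℕ} (hj : j < n) (y : ℝ) :
    ∑ i ∈ range (n + 1), (-1 : ℝ) ^ i * n.choose i * (y - i) ^ j = 0 := by
  have h := congrFun (fwdDiff_iter_pow_eq_zero_of_lt (R := ℝ) hj) (y - n)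
  rw [fwdDiff_iter_eq_sum_shift, ← sum_range_reflect] at h
  rw [← Pi.zero_apply (M := fun _ : ℝ ↦ ℝ) (y - n), ← h]
  refine sum_congr rfl fun i hi ↦ ?_
  have hi : i ≤ n := Nat.lt_succ_iff.1 (mem_range.1 hi)
  rw [show n + 1 - 1 - i = n - i by lia, Nat.sub_sub_self hi, Nat.choose_symm hi]
  simp [Nat.cast_sub hi]

theorem sin_pow_two_mul (k : ℕ) (x : ℝ) :
    sin x ^ (2 * k) = (-1) ^ k / 4 ^ k *
      ∑ i ∈ range (2 * k + 1), (-1) ^ i * (2 * k).choose i * cos (2 * (k - i) * x) := by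
  have hsin : 2 * Complex.I * Complex.sin x =
      -Complex.exp (-(x * Complex.I)) + Complex.exp (x * Complex.I) := by
    rw [Complex.sin]
    ring_nf
    simp
  have h : ((-4 : ℝ) ^ k * sin x ^ (2 * k) : ℂ) =
      ∑ i ∈ range (2 * k + 1), ((-1) ^ i * (2 * k).choose i : ℝ) *
        Complex.exp ((2 * (k - i) * x : ℝ) * Complex.I) := by
    calc ((-4 : ℝ) ^ k * sin x ^ (2 * k) : ℂ) = (2 * Complex.I * Complex.sin x) ^ (2 * k) := by
          rw [mul_pow, pow_mul (2 * Complex.I), mul_pow, Complex.I_sq]; push_cast; norm_num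
      _ = _ := by
        rw [hsin, add_pow]
        refine sum_congr rfl fun i hi ↦ ?_
        have hi : i ≤ 2 * k := Nat.lt_succ_iff.1 (mem_range.1 hi)
        rw [neg_pow, ← Complex.exp_nat_mul, ← Complex.exp_nat_mul, mul_assoc ((-1) ^ i),
          ← Complex.exp_add, Nat.cast_sub hi]
        push_cast
        ring_nf
  have h' := congrArg Complex.re h
  rw [Complex.re_sum] at h'
  simp only [Complex.re_ofReal_mul, Complex.exp_ofReal_mul_I_re] at h'
  rw [← h', ← Complex.ofReal_pow, ← Complex.ofReal_pow, ← Complex.ofReal_mul, Complex.ofReal_re,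
    ← mul_assoc, ← div_pow, ← mul_pow]
  norm_num

theorem sin_pow_two_mul_eq_sum_cosRemainder (k : ℕ) (x : ℝ) :
    sin x ^ (2 * k) = (4 ^ k)⁻¹ * ∑ i ∈ range (2 * k + 1),
      (-1) ^ i * (2 * k).choose i * cosRemainder (2 * k) (2 * (k - i) * x) := by
  have h : ∑ i ∈ range (2 * k + 1), (-1) ^ i * ((2 * k).choose i : ℝ) *
      ∑ j ∈ range k, (-1) ^ j * (2 * (k - i) * x) ^ (2 * j) / (2 * j).factorial = 0 := by
    simp_rw [mul_sum]
    rw [sum_comm]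
    refine sum_eq_zero fun j hj ↦ ?_
    have := sum_neg_one_pow_mul_choose_mul_sub_pow_eq_zero (n := 2 * k) (j := 2 * j)
      (by have := mem_range.1 hj; lia) k
    rw [← mul_zero ((-1) ^ j * (2 * x) ^ (2 * j) / (2 * j).factorial), ← this, mul_sum]
    refine sum_congr rfl fun i _ ↦ ?_
    simp only [mul_pow]
    ring
  rw [sin_pow_two_mul, div_eq_inv_mul, mul_assoc, ← sub_zero (Finset.sum _ _), ← h,
    ← sum_sub_distrib, mul_sum]
  congr 1
  refine sum_congr rfl fun i _ ↦ ?_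
  rw [cosRemainder_two_mul]
  ring

theorem abs_pow_eq_two_mul_max_pow_sub {n : ℕ} (hn : Odd n) (x : ℝ) :
    |x| ^ n = 2 * max x 0 ^ n - x ^ n := by
  rcases le_total 0 x with hx | hx
  · rw [abs_of_nonneg hx, max_eq_left hx]; ring
  · rw [abs_of_nonpos hx, max_eq_right hx, hn.neg_pow, zero_pow hn.pos.ne']; ring

theorem sum_neg_one_pow_mul_choose_mul_abs_pow {k : ℕ} (hk : 1 ≤ k) :
    ∑ i ∈ range (2 * k + 1), (-1 : ℝ) ^ i * (2 * k).choose i * |(k : ℝ) - i| ^ (2 * k - 1) =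
      2 * ∑ i ∈ range (2 * k + 1),
        (-1 : ℝ) ^ i * (2 * k).choose i * max ((k : ℝ) - i) 0 ^ (2 * k - 1) := by
  have hodd : Odd (2 * k - 1) := ⟨k - 1, by lia⟩
  have h := sum_neg_one_pow_mul_choose_mul_sub_pow_eq_zero (show 2 * k - 1 < 2 * k by lia) k
  simp_rw [abs_pow_eq_two_mul_max_pow_sub hodd, mul_sub, sum_sub_distrib, h, sub_zero, mul_sum]
  exact sum_congr rfl fun i _ ↦ by ring

theorem dirichlet_integral_via_convolution (k : ℕ) (hk : 1 ≤ k) :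
    (∫ u : ℝ, (Real.sin u / u) ^ (2 * k)) =
        π / (Nat.factorial (2 * k - 1)) *
          ∑ i ∈ Finset.range (2 * k + 1),
            (-1 : ℝ) ^ i * (Nat.choose (2 * k) i) * (max ((k : ℝ) - i) 0) ^ (2 * k - 1) ∧
    (∑ i ∈ Finset.range (2 * k + 1),
        (-1 : ℝ) ^ i * (Nat.choose (2 * k) i) * (max ((k : ℝ) - i) 0) ^ (2 * k - 1)) =
      ∑ i ∈ Finset.range k,
        (-1 : ℝ) ^ i * (Nat.choose (2 * k) i) * ((k : ℝ) - i) ^ (2 * k - 1) := by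
  constructor
  · have heven (u : ℝ) : (sin u / u) ^ (2 * k) = (sin |u| / |u|) ^ (2 * k) := by
      rcases abs_cases u with h | h <;> simp [h.1]
    have hsum (u : ℝ) : (sin u / u) ^ (2 * k) = (4 ^ k)⁻¹ * ∑ i ∈ range (2 * k + 1),
        (-1) ^ i * (2 * k).choose i * (cosRemainder (2 * k) (2 * (k - i) * u) / u ^ (2 * k)) := by
      rw [div_pow, sin_pow_two_mul_eq_sum_cosRemainder, mul_div_assoc, sum_div]
      simp only [mul_div_assoc]
    rw [integral_congr_ae (.of_forall heven),
      integral_comp_abs (f := fun u ↦ (sin u / u) ^ (2 * k))]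
    simp_rw [hsum]
    rw [integral_const_mul, integral_finsetSum _
      fun i _ ↦ (integrableOn_cosRemainder_mul_div_pow hk _).const_mul _]
    simp_rw [integral_const_mul, integral_cosRemainder_mul_div_pow hk, abs_mul, mul_pow, abs_two]
    have hterm (i : ℕ) : (-1 : ℝ) ^ i * (2 * k).choose i *
        (2 ^ (2 * k - 1) * |(k : ℝ) - i| ^ (2 * k - 1) * (π / (2 * (2 * k - 1).factorial))) =
        2 ^ (2 * k - 1) * (π / (2 * (2 * k - 1).factorial)) *
          ((-1 : ℝ) ^ i * (2 * k).choose i * |(k : ℝ) - i| ^ (2 * k - 1)) := by ring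
    have hpow : (4 : ℝ) ^ k = 2 * 2 ^ (2 * k - 1) := by
      rw [← pow_succ', show 2 * k - 1 + 1 = 2 * k by lia, pow_mul]
      norm_num
    simp_rw [hterm]
    rw [← mul_sum, sum_neg_one_pow_mul_choose_mul_abs_pow hk, hpow]
    field_simp
  · rw [← sum_subset (range_subset_range.2 (show k ≤ 2 * k + 1 by lia)) fun i _ hi ↦ ?_]
    · refine sum_congr rfl fun i hi ↦ ?_
      rw [max_eq_left (sub_nonneg.2 (Nat.cast_le.2 (mem_range.1 hi).le))]
    · rw [max_eq_right (sub_nonpos.2 (Nat.cast_le.2 (not_lt.1 (mt mem_range.2 hi)))),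
        zero_pow (by lia), mul_zero]
end
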